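/- arXiv:1602.06755 — 3 statements merged into one kernel-verified Lean document; each statement's English description precedes it below -/
import Mathlib

section
/- Let $Z$ be a compact geodesic metric space homeomorphic to $\overline{D}$ satisfying: (a) every Jordan curve $T\subset Z$ of length $\ell_Z(T)<l_0$ bounds a Jordan domain of $\mathcal H^2$-area at most $C\ell_Z(T)^2$, and (b) the area-growth bound $\mathcal H^2(B(z,r))\geq\min\{\tfrac{\pi^2}{64C}r^2, Cl_0^2\}$ for balls not meeting $\partial Z$. Then for every $z\in Z$ and every $0<r<l_0/2$, the ball $B(z,r)$ is contractible inside the ball $B(z,(8C+1)r)$. -/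
open Set MeasureTheory Metric
open scoped ENNReal Real

/-- A geodesic metric space: any two points are joined by an isometrically parametrized
segment. -/
def IsGeodesicSpace (Z : Type*) [MetricSpace Z] : Prop :=
  ∀ x y : Z, ∃ γ : ℝ → Z, γ 0 = x ∧ γ (dist x y) = y ∧
    ∀ s ∈ Icc (0 : ℝ) (dist x y), ∀ t ∈ Icc (0 : ℝ) (dist x y),
      dist (γ s) (γ t) = |s - t|

/-- `f` admits a continuous logarithm on the set `S`. -/
def HasLogOn {X : Type*} [TopologicalSpace X] (f : X → ℂ) (S : Set X) : Prop :=
  ∃ g : X → ℂ, ContinuousOn g S ∧ ∀ x ∈ S, Complex.exp (g x) = f x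

section HasLogOn

variable {X Y : Type*} [TopologicalSpace X] [TopologicalSpace Y]

theorem HasLogOn.mono {f : X → ℂ} {S T : Set X} (h : HasLogOn f T) (hST : S ⊆ T) :
    HasLogOn f S := by
  obtain ⟨g, hg, hgf⟩ := h
  exact ⟨g, hg.mono hST, fun x hx => hgf x (hST hx)⟩

theorem HasLogOn.comp {f : X → ℂ} {S : Set X} (h : HasLogOn f S) {e : Y → X} {T : Set Y}
    (he : ContinuousOn e T) (hm : MapsTo e T S) : HasLogOn (fun y => f (e y)) T := by
  obtain ⟨g, hg, hgf⟩ := h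
  exact ⟨fun y => g (e y), hg.comp he hm, fun y hy => hgf _ (hm hy)⟩

theorem HasLogOn.congr {f k : X → ℂ} {S : Set X} (h : HasLogOn f S) (hfk : EqOn k f S) :
    HasLogOn k S := by
  obtain ⟨g, hg, hgf⟩ := h
  exact ⟨g, hg, fun x hx => (hgf x hx).trans (hfk hx).symm⟩

theorem HasLogOn.mul {f k : X → ℂ} {S : Set X} (hf : HasLogOn f S) (hk : HasLogOn k S) :
    HasLogOn (fun x => f x * k x) S := by
  obtain ⟨g, hg, hgf⟩ := hf
  obtain ⟨l, hl, hlk⟩ := hk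
  exact ⟨fun x => g x + l x, hg.add hl, fun x hx => by rw [Complex.exp_add, hgf x hx, hlk x hx]⟩

theorem hasLogOn_of_mem_slitPlane {f : X → ℂ} {S : Set X} (hf : ContinuousOn f S)
    (h : ∀ x ∈ S, f x ∈ Complex.slitPlane) : HasLogOn f S :=
  ⟨fun x => Complex.log (f x), hf.clog h,
    fun x hx => Complex.exp_log (Complex.slitPlane_ne_zero (h x hx))⟩

theorem hasLogOn_const {c : ℂ} (hc : c ≠ 0) (S : Set X) : HasLogOn (fun _ => c) S :=
  ⟨fun _ => Complex.log c, continuousOn_const, fun _ _ => Complex.exp_log hc⟩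

/-- Two logarithms of the same function on a preconnected set differ by a constant. -/
theorem IsPreconnected.sub_eq_sub_of_exp_eq {S : Set X} (hS : IsPreconnected S) {g h : X → ℂ}
    (hg : ContinuousOn g S) (hh : ContinuousOn h S)
    (hgh : ∀ x ∈ S, Complex.exp (g x) = Complex.exp (h x)) {x y : X} (hx : x ∈ S) (hy : y ∈ S) :
    g x - h x = g y - h y := by
  have h1 : Complex.exp (g x - h x) = 1 := by
    rw [Complex.exp_sub, hgh x hx, div_self (Complex.exp_ne_zero _)]
  have key := Complex.isCoveringMap_exp.eqOn_of_comp_eqOn (g₁ := g)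
    (g₂ := fun w => h w + (g x - h x)) hS hg (hh.add continuousOn_const) (by
      intro w hw
      simp only [Function.comp_apply, Subtype.mk.injEq]
      rw [Complex.exp_add, h1, mul_one, hgh w hw]) hx (by ring)
  have := key hy
  simp only at this
  rw [this]; ring

theorem exists_log_of_simplyConnected {A : Type*} [TopologicalSpace A] [SimplyConnectedSpace A]
    [LocallyPathConnectedSpace A] {f : A → ℂ} (hf : Continuous f) (h0 : ∀ a, f a ≠ 0) :
    ∃ g : A → ℂ, Continuous g ∧ ∀ a, Complex.exp (g a) = f a := by
  obtain ⟨a₀⟩ := (inferInstance : Nonempty A)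
  obtain ⟨F, ⟨-, hF⟩, -⟩ := Complex.isCoveringMap_exp.existsUnique_continuousMap_lifts
    (⟨fun a => ⟨f a, h0 a⟩, by fun_prop⟩ : C(A, {z : ℂ // z ≠ 0})) a₀ (Complex.log (f a₀))
    (by simp [Complex.exp_log (h0 a₀)])
  refine ⟨F, F.continuous, fun a => ?_⟩
  exact congrArg Subtype.val (congrFun hF a)

/-- A nonvanishing continuous function has a logarithm on any arc. -/
theorem hasLogOn_image_Icc [T2Space X] {γ : ℝ → X} {L : ℝ} (hL : 0 ≤ L)
    (hγ : ContinuousOn γ (Icc 0 L)) (hinj : InjOn γ (Icc 0 L)) {f : X → ℂ}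
    (hf : ContinuousOn f (γ '' Icc 0 L)) (h0 : ∀ x ∈ γ '' Icc 0 L, f x ≠ 0) :
    HasLogOn f (γ '' Icc 0 L) := by
  let F : ℝ → ℂ := fun t => f (γ (projIcc 0 L hL t))
  have hF : Continuous F := by
    have h1 : ContinuousOn (fun t => f (γ t)) (Icc 0 L) := hf.comp hγ (mapsTo_image _ _)
    exact (continuousOn_iff_continuous_domRestrict.1 h1).comp continuous_projIcc
  obtain ⟨G, hG, hGF⟩ := exists_log_of_simplyConnected hF
    (fun t => h0 _ (mem_image_of_mem _ (projIcc 0 L hL t).2))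
  have hinv : ContinuousOn (Function.invFunOn γ (Icc 0 L)) (γ '' Icc 0 L) := by
    rw [continuousOn_iff_isClosed]
    intro t ht
    refine ⟨γ '' (Icc 0 L ∩ t), ?_, ?_⟩
    · exact ((isCompact_Icc.inter_right ht).image_of_continuousOn
        (hγ.mono inter_subset_left)).isClosed
    · ext x
      constructor
      · rintro ⟨hx, s, hs, rfl⟩
        rw [mem_preimage, hinj.leftInvOn_invFunOn hs] at hx
        exact ⟨⟨s, ⟨hs, hx⟩, rfl⟩, s, hs, rfl⟩
      · rintro ⟨⟨s, ⟨hs, hst⟩, rfl⟩, -⟩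
        refine ⟨?_, s, hs, rfl⟩
        rwa [mem_preimage, hinj.leftInvOn_invFunOn hs]
  refine ⟨fun x => G (Function.invFunOn γ (Icc 0 L) x), hG.comp_continuousOn hinv, ?_⟩
  rintro _ ⟨s, hs, rfl⟩
  simp only [hinj.leftInvOn_invFunOn hs, hGF, F, projIcc_of_mem hL hs]

end HasLogOn

/-- The function `w - p` has no logarithm on a circle around `p`. -/
theorem not_hasLogOn_sphere (p : ℂ) {R : ℝ} (hR : 0 < R) :
    ¬ HasLogOn (fun w => w - p) (sphere p R) := by
  intro h
  obtain ⟨g, hg, hgf⟩ := h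
  have key := isPreconnected_univ.sub_eq_sub_of_exp_eq
    (g := fun t : ℝ => g (circleMap p R t)) (h := fun t : ℝ => Real.log R + t * Complex.I)
    (hg.comp (continuous_circleMap p R).continuousOn
      (fun t _ => circleMap_mem_sphere p hR.le t)) (by fun_prop) (by
      intro t _
      rw [hgf _ (circleMap_mem_sphere p hR.le t), Complex.exp_add, ← Complex.ofReal_exp,
        Real.exp_log hR]
      simp [circleMap]) (mem_univ 0) (mem_univ (2 * π))
  have hper : circleMap p R (2 * π) = circleMap p R 0 := by
    simpa using periodic_circleMap p R 0
  simp only [hper] at key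
  have := sub_right_injective key
  simp at this

/-- A point of a bounded planar set cannot be unlinked from the frontier of the set. -/
theorem not_hasLogOn_frontier {O : Set ℂ} (hb : Bornology.IsBounded O) {p : ℂ}
    (hp : p ∈ O) : ¬ HasLogOn (fun w => w - p) (frontier O) := by
  rintro ⟨g, hg, hgf⟩
  obtain ⟨G, hG⟩ := ContinuousMap.exists_restrict_eq (Y := ℂ) (isClosed_frontier (s := O))
    ⟨_, continuousOn_iff_continuous_domRestrict.1 hg⟩
  have hGg : ∀ w ∈ frontier O, G w = g w := fun w hw => congrArg (fun k => k ⟨w, hw⟩) hG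
  classical
  let F : ℂ → ℂ := O.piecewise (fun w => Complex.exp (G w)) (fun w => w - p)
  have hF : Continuous F := by
    refine continuous_piecewise ?_ ?_ ?_
    · intro w hw
      rw [hGg w hw, hgf w hw]
    · fun_prop
    · fun_prop
  have hF0 : ∀ w, F w ≠ 0 := by
    intro w
    by_cases hw : w ∈ O
    · simp only [F, piecewise_eq_of_mem _ _ _ hw]
      exact Complex.exp_ne_zero _
    · simp only [F, piecewise_eq_of_notMem _ _ _ hw]
      intro h
      exact hw (by rwa [sub_eq_zero.1 h])
  obtain ⟨l, hl, hlF⟩ := exists_log_of_simplyConnected hF hF0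
  obtain ⟨R, hR⟩ := hb.subset_ball p
  have hR0 : 0 < R := by simpa using (mem_ball.1 (hR hp))
  refine not_hasLogOn_sphere p hR0 ⟨l, hl.continuousOn, fun w hw => ?_⟩
  have hwO : w ∉ O := fun h => by
    have := mem_ball.1 (hR h); rw [mem_sphere.1 hw] at this; exact lt_irrefl _ this
  rw [hlF]; simp only [F, piecewise_eq_of_notMem _ _ _ hwO]

/-- Existence of a logarithm of `Φ - p` on a compact set `T` only depends on the component of `p`
in the complement of `T`. -/
theorem HasLogOn.of_isPreconnected {X : Type*} [TopologicalSpace X] {Φ : X → ℂ}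
    {T : Set X} (hΦ : ContinuousOn Φ T) (hT : IsCompact T) {A : Set ℂ} (hA : IsPreconnected A)
    (hAT : Disjoint A (Φ '' T)) {p q : ℂ} (hp : p ∈ A) (hq : q ∈ A)
    (hlog : HasLogOn (fun x => Φ x - q) T) : HasLogOn (fun x => Φ x - p) T := by
  have hcl : IsClosed (Φ '' T) := (hT.image_of_continuousOn hΦ).isClosed
  have step : ∀ a ∈ (Φ '' T)ᶜ, ∃ ε > 0, ball a ε ⊆ (Φ '' T)ᶜ ∧ ∀ b ∈ ball a ε,
      (HasLogOn (fun x => Φ x - a) T ↔ HasLogOn (fun x => Φ x - b) T) := by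
    intro a ha
    obtain ⟨ε, hε, hball⟩ := Metric.isOpen_iff.1 hcl.isOpen_compl a ha
    refine ⟨ε, hε, hball, fun b hb => ?_⟩
    have hfar : ∀ x ∈ T, ε ≤ ‖Φ x - a‖ := by
      intro x hx
      by_contra! hlt
      exact hball (by rwa [mem_ball, dist_eq_norm]) (mem_image_of_mem _ hx)
    have hna : ∀ x ∈ T, Φ x - a ≠ 0 := fun x hx h => by
      have := hfar x hx; rw [h, norm_zero] at this; linarith
    have hnb : ∀ x ∈ T, Φ x - b ≠ 0 := fun x hx h =>
      hball hb (by rw [← sub_eq_zero.1 h]; exact mem_image_of_mem _ hx)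
    have hslit : ∀ x ∈ T, (Φ x - b) / (Φ x - a) ∈ Complex.slitPlane := by
      intro x hx
      have h1 : (Φ x - b) / (Φ x - a) = 1 + (a - b) / (Φ x - a) := by
        field_simp [hna x hx]; ring
      rw [h1]
      apply Complex.mem_slitPlane_of_norm_lt_one
      rw [norm_div, div_lt_one (norm_pos_iff.2 (hna x hx))]
      rw [mem_ball, dist_comm, dist_eq_norm] at hb
      exact hb.trans_le (hfar x hx)
    have hr : HasLogOn (fun x => (Φ x - b) / (Φ x - a)) T :=
      hasLogOn_of_mem_slitPlane ((hΦ.sub continuousOn_const).div (hΦ.sub continuousOn_const) hna)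
        hslit
    constructor
    · intro h
      refine (h.mul hr).congr fun x hx => ?_
      simp only
      rw [mul_div_cancel₀ _ (hna x hx)]
    · rintro ⟨g, hg, hgf⟩
      obtain ⟨l, hl, hlf⟩ := hr
      refine ⟨fun x => g x - l x, hg.sub hl, fun x hx => ?_⟩
      rw [Complex.exp_sub, hgf x hx, hlf x hx]
      have := hnb x hx
      field_simp
  have hopen : ∀ P : Prop → Prop, IsOpen {a | a ∈ (Φ '' T)ᶜ ∧ P (HasLogOn (fun x => Φ x - a) T)} := by
    intro P
    rw [Metric.isOpen_iff]
    rintro a ⟨ha, hPa⟩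
    obtain ⟨ε, hε, hball, hiff⟩ := step a ha
    refine ⟨ε, hε, fun b hb => ⟨hball hb, ?_⟩⟩
    rwa [← propext (hiff b hb)]
  by_contra hcon
  have hAc : A ⊆ (Φ '' T)ᶜ := hAT.subset_compl_right
  obtain ⟨w, -, hw1, hw2⟩ := hA _ _ (hopen id) (hopen Not) (fun a ha => by
    by_cases h : HasLogOn (fun x => Φ x - a) T
    · exact Or.inl ⟨hAc ha, h⟩
    · exact Or.inr ⟨hAc ha, h⟩) ⟨q, hq, hAc hq, hlog⟩ ⟨p, hp, hAc hp, hcon⟩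
  exact hw2.2 hw1.2

/-- `S` is an arc from `a` to `b`: an injectively parametrized compact curve. -/
def IsArc {X : Type*} [TopologicalSpace X] (S : Set X) (a b : X) : Prop :=
  ∃ (L : ℝ) (γ : ℝ → X), 0 < L ∧ ContinuousOn γ (Icc 0 L) ∧ InjOn γ (Icc 0 L) ∧
    γ '' Icc 0 L = S ∧ γ 0 = a ∧ γ L = b

/-- Any two distinct points of `S` are joined by an arc inside `S`. -/
def IsArcConnected {X : Type*} [TopologicalSpace X] (S : Set X) : Prop :=
  ∀ a ∈ S, ∀ b ∈ S, a ≠ b → ∃ A ⊆ S, IsArc A a b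

section Arc

variable {X : Type*} [TopologicalSpace X]

theorem IsArc.left_mem {S : Set X} {a b : X} (h : IsArc S a b) : a ∈ S := by
  obtain ⟨L, γ, hL, -, -, rfl, rfl, -⟩ := h
  exact mem_image_of_mem _ ⟨le_rfl, hL.le⟩

theorem IsArc.right_mem {S : Set X} {a b : X} (h : IsArc S a b) : b ∈ S := by
  obtain ⟨L, γ, hL, -, -, rfl, -, rfl⟩ := h
  exact mem_image_of_mem _ ⟨hL.le, le_rfl⟩

theorem IsArc.isCompact {S : Set X} {a b : X} (h : IsArc S a b) : IsCompact S := by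
  obtain ⟨L, γ, -, hγ, -, rfl, -, -⟩ := h
  exact isCompact_Icc.image_of_continuousOn hγ

theorem IsArc.isPreconnected {S : Set X} {a b : X} (h : IsArc S a b) : IsPreconnected S := by
  obtain ⟨L, γ, -, hγ, -, rfl, -, -⟩ := h
  exact isPreconnected_Icc.image _ hγ

theorem IsArc.hasLogOn [T2Space X] {S : Set X} {a b : X} (h : IsArc S a b) {f : X → ℂ}
    (hf : ContinuousOn f S) (h0 : ∀ x ∈ S, f x ≠ 0) : HasLogOn f S := by
  obtain ⟨L, γ, hL, hγ, hinj, rfl, -, -⟩ := h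
  exact hasLogOn_image_Icc hL.le hγ hinj hf h0

/-- A subinterval of an injectively parametrized curve is an arc. -/
theorem isArc_image_Icc {γ : ℝ → X} {s t : ℝ} (hst : s < t) (hγ : ContinuousOn γ (Icc s t))
    (hinj : InjOn γ (Icc s t)) : IsArc (γ '' Icc s t) (γ s) (γ t) := by
  have hm : MapsTo (fun u => s + u) (Icc 0 (t - s)) (Icc s t) := fun u hu =>
    ⟨by linarith [hu.1], by linarith [hu.2]⟩
  refine ⟨t - s, fun u => γ (s + u), sub_pos.2 hst, hγ.comp (by fun_prop) hm, ?_, ?_, ?_, ?_⟩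
  · intro u hu v hv huv
    have := hinj (hm hu) (hm hv) huv
    linarith
  · ext x
    constructor
    · rintro ⟨u, hu, rfl⟩
      exact ⟨s + u, hm hu, rfl⟩
    · rintro ⟨u, hu, rfl⟩
      exact ⟨u - s, ⟨by linarith [hu.1], by linarith [hu.2]⟩, by simp⟩
  · simp
  · simp

theorem IsArc.symm {S : Set X} {a b : X} (h : IsArc S a b) : IsArc S b a := by
  obtain ⟨L, γ, hL, hγ, hinj, rfl, rfl, rfl⟩ := h
  have hm : MapsTo (fun u => L - u) (Icc 0 L) (Icc 0 L) := fun u hu =>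
    ⟨by linarith [hu.2], by linarith [hu.1]⟩
  refine ⟨L, fun u => γ (L - u), hL, hγ.comp (by fun_prop) hm, ?_, ?_, by simp, by simp⟩
  · intro u hu v hv huv
    have := hinj (hm hu) (hm hv) huv
    linarith
  · ext x
    constructor
    · rintro ⟨u, hu, rfl⟩
      exact ⟨L - u, hm hu, rfl⟩
    · rintro ⟨u, hu, rfl⟩
      exact ⟨L - u, hm hu, by simp⟩

/-- Concatenation of two parametrized curves. -/
theorem exists_concat {γ δ : ℝ → X} {L M : ℝ} (hL : 0 < L) (hM : 0 < M)
    (hγ : ContinuousOn γ (Icc 0 L)) (hδ : ContinuousOn δ (Icc 0 M)) (h : γ L = δ 0) :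
    ∃ η : ℝ → X, ContinuousOn η (Icc 0 (L + M)) ∧ (∀ t ≤ L, η t = γ t) ∧
      (∀ t ≥ L, η t = δ (t - L)) ∧ η '' Icc 0 (L + M) = γ '' Icc 0 L ∪ δ '' Icc 0 M := by
  let η : ℝ → X := fun t => if t ≤ L then γ t else δ (t - L)
  have h1 : ∀ t ≤ L, η t = γ t := fun t ht => if_pos ht
  have h2 : ∀ t ≥ L, η t = δ (t - L) := by
    intro t ht
    rcases ht.eq_or_lt with rfl | hlt
    · simp [η, h]
    · exact if_neg (not_le.2 hlt)
  have hm : MapsTo (fun t => t - L) (Icc L (L + M)) (Icc 0 M) := fun u hu =>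
    ⟨by linarith [hu.1], by linarith [hu.2]⟩
  have hun : Icc 0 (L + M) = Icc 0 L ∪ Icc L (L + M) :=
    (Icc_union_Icc_eq_Icc hL.le (by linarith)).symm
  refine ⟨η, ?_, h1, h2, ?_⟩
  · rw [hun]
    refine ContinuousOn.union_of_isClosed ?_ ?_ isClosed_Icc isClosed_Icc
    · exact hγ.congr fun t ht => h1 t ht.2
    · exact (hδ.comp (by fun_prop) hm).congr fun t ht => h2 t ht.1
  · rw [hun, image_union]
    congr 1
    · exact image_congr fun t ht => h1 t ht.2
    · ext x
      constructor
      · rintro ⟨t, ht, rfl⟩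
        exact ⟨t - L, hm ht, (h2 t ht.1).symm⟩
      · rintro ⟨t, ht, rfl⟩
        refine ⟨t + L, ⟨by linarith [ht.1], by linarith [ht.2]⟩, ?_⟩
        rw [h2 _ (by linarith [ht.1])]; simp

theorem IsArc.union {S T : Set X} {a b c : X} (hS : IsArc S a b) (hT : IsArc T b c)
    (hST : S ∩ T ⊆ {b}) : IsArc (S ∪ T) a c := by
  obtain ⟨L, γ, hL, hγ, hγi, rfl, rfl, rfl⟩ := hS
  obtain ⟨M, δ, hM, hδ, hδi, rfl, h0, rfl⟩ := hT
  obtain ⟨η, hη, h1, h2, him⟩ := exists_concat hL hM hγ hδ h0.symm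
  refine ⟨L + M, η, by linarith, hη, ?_, him, h1 0 hL.le, by rw [h2 _ (by linarith)]; simp⟩
  have hmix : ∀ s ∈ Icc (0 : ℝ) (L + M), ∀ t ∈ Icc (0 : ℝ) (L + M), s ≤ L → L ≤ t →
      η s = η t → s = t := by
    intro s hs t ht hsL hLt heq
    rw [h1 s hsL, h2 t hLt] at heq
    have htM : t - L ∈ Icc 0 M := ⟨by linarith, by linarith [ht.2]⟩
    have hmem : γ s ∈ γ '' Icc 0 L ∩ δ '' Icc 0 M :=
      ⟨⟨s, ⟨hs.1, hsL⟩, rfl⟩, ⟨t - L, htM, heq.symm⟩⟩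
    have hb : γ s = γ L := hST hmem
    have e1 := hγi ⟨hs.1, hsL⟩ ⟨hL.le, le_rfl⟩ hb
    have e2 := hδi htM ⟨le_rfl, hM.le⟩ (by rw [← heq, hb, h0])
    linarith
  intro s hs t ht heq
  rcases le_total s L with hsL | hsL <;> rcases le_total t L with htL | htL
  · rw [h1 s hsL, h1 t htL] at heq
    exact hγi ⟨hs.1, hsL⟩ ⟨ht.1, htL⟩ heq
  · exact hmix s hs t ht hsL htL heq
  · exact (hmix t ht s hs htL hsL heq.symm).symm
  · rw [h2 s hsL, h2 t htL] at heq
    have := hδi (x₁ := s - L) (x₂ := t - L) ⟨by linarith, by linarith [hs.2]⟩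
      ⟨by linarith, by linarith [ht.2]⟩ heq
    linarith

/-- Two arcs with the same endpoints and otherwise disjoint form a Jordan curve. -/
theorem IsArc.homeomorph_circle [T2Space X] {S T : Set X} {a b : X} (hS : IsArc S a b)
    (hT : IsArc T b a) (hST : S ∩ T ⊆ {a, b}) : Nonempty (↥(S ∪ T) ≃ₜ Circle) := by
  obtain ⟨L, γ, hL, hγ, hγi, rfl, ha, hb⟩ := hS
  obtain ⟨M, δ, hM, hδ, hδi, rfl, h0, h1'⟩ := hT
  obtain ⟨η, hη, h1, h2, him⟩ := exists_concat hL hM hγ hδ (hb.trans h0.symm)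
  have hper : η 0 = η (0 + (L + M)) := by
    rw [h1 0 hL.le, h2 _ (by linarith), ha]; simp [h1']
  have hmix : ∀ s ∈ Ico (0 : ℝ) (L + M), ∀ t ∈ Ico (0 : ℝ) (L + M), s ≤ L → L ≤ t →
      η s = η t → s = t := by
    intro s hs t ht hsL hLt heq
    rw [h1 s hsL, h2 t hLt] at heq
    have htM : t - L ∈ Icc 0 M := ⟨by linarith, by linarith [ht.2]⟩
    have hmem : γ s ∈ γ '' Icc 0 L ∩ δ '' Icc 0 M :=
      ⟨⟨s, ⟨hs.1, hsL⟩, rfl⟩, ⟨t - L, htM, heq.symm⟩⟩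
    rcases hST hmem with h | h
    · have e2 := hδi htM ⟨hM.le, le_rfl⟩ (by rw [← heq, h, h1'])
      linarith [ht.2]
    · have e1 := hγi ⟨hs.1, hsL⟩ ⟨hL.le, le_rfl⟩ (h.trans hb.symm)
      have e2 := hδi htM ⟨le_rfl, hM.le⟩ (by rw [← heq, h, h0])
      linarith
  have hinj : InjOn η (Ico 0 (L + M)) := by
    intro s hs t ht heq
    rcases le_total s L with hsL | hsL <;> rcases le_total t L with htL | htL
    · rw [h1 s hsL, h1 t htL] at heq
      exact hγi ⟨hs.1, hsL⟩ ⟨ht.1, htL⟩ heq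
    · exact hmix s hs t ht hsL htL heq
    · exact (hmix t ht s hs htL hsL heq.symm).symm
    · rw [h2 s hsL, h2 t htL] at heq
      have := hδi (x₁ := s - L) (x₂ := t - L) ⟨by linarith, by linarith [hs.2]⟩
        ⟨by linarith, by linarith [ht.2]⟩ heq
      linarith
  have hpos : 0 < L + M := by linarith
  have : Fact (0 < L + M) := ⟨hpos⟩
  let f : AddCircle (L + M) → X := AddCircle.liftIco (L + M) 0 η
  have hf : Continuous f := AddCircle.liftIco_continuous hper (by simpa using hη)
  have hfc : ∀ t ∈ Ico (0 : ℝ) (L + M), f (t : AddCircle (L + M)) = η t := fun t ht =>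
    AddCircle.liftIco_coe_apply (by simpa using ht)
  have hrep : ∀ x : AddCircle (L + M), ∃ t ∈ Ico (0 : ℝ) (L + M), (t : AddCircle (L + M)) = x := by
    intro x
    have := AddCircle.coe_image_Ico_eq (L + M) 0
    obtain ⟨t, ht, rfl⟩ := this.symm ▸ mem_univ x
    exact ⟨t, by simpa using ht, rfl⟩
  have hfi : Function.Injective f := by
    intro x y hxy
    obtain ⟨s, hs, rfl⟩ := hrep x
    obtain ⟨t, ht, rfl⟩ := hrep y
    rw [hfc s hs, hfc t ht] at hxy
    rw [hinj hs ht hxy]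
  have hrange : range f = γ '' Icc 0 L ∪ δ '' Icc 0 M := by
    rw [← him]
    ext x
    constructor
    · rintro ⟨y, rfl⟩
      obtain ⟨s, hs, rfl⟩ := hrep y
      exact ⟨s, Ico_subset_Icc_self hs, (hfc s hs).symm⟩
    · rintro ⟨s, hs, rfl⟩
      rcases hs.2.eq_or_lt with h | h
      · refine ⟨((0 : ℝ) : AddCircle (L + M)), ?_⟩
        rw [hfc 0 ⟨le_rfl, hpos⟩, hper, h, zero_add]
      · exact ⟨_, hfc s ⟨hs.1, h⟩⟩
  have hemb : Topology.IsEmbedding f := (hf.isClosedEmbedding hfi).isEmbedding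
  exact ⟨((Homeomorph.setCongr hrange.symm).trans hemb.toHomeomorph.symm).trans
    (AddCircle.homeomorphCircle hpos.ne')⟩

theorem IsArc.isArcConnected {S : Set X} {a b : X} (h : IsArc S a b) : IsArcConnected S := by
  obtain ⟨L, γ, hL, hγ, hinj, rfl, -, -⟩ := h
  have main : ∀ s ∈ Icc 0 L, ∀ t ∈ Icc 0 L, s < t → ∃ A ⊆ γ '' Icc 0 L, IsArc A (γ s) (γ t) := by
    intro s hs t ht hst
    have hsub : Icc s t ⊆ Icc 0 L := Icc_subset_Icc hs.1 ht.2
    exact ⟨_, image_mono hsub, isArc_image_Icc hst (hγ.mono hsub) (hinj.mono hsub)⟩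
  rintro _ ⟨s, hs, rfl⟩ _ ⟨t, ht, rfl⟩ hne
  rcases lt_trichotomy s t with hst | rfl | hst
  · exact main s hs t ht hst
  · exact absurd rfl hne
  · obtain ⟨A, hA, h⟩ := main t ht s hs hst
    exact ⟨A, hA, h.symm⟩

/-- An arc starting outside a closed set `A` and ending inside contains a subarc which meets `A`
only at its endpoint. -/
theorem IsArc.exists_subarc_inter_eq {A S : Set X} (hA : IsClosed A) {a b : X} (hS : IsArc S a b)
    (ha : a ∉ A) (hb : b ∈ A) : ∃ c ∈ A, ∃ B ⊆ S, IsArc B a c ∧ A ∩ B ⊆ {c} := by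
  obtain ⟨L, γ, hL, hγ, hinj, rfl, rfl, rfl⟩ := hS
  let K := Icc 0 L ∩ γ ⁻¹' A
  have hK : IsCompact K := isCompact_Icc.of_isClosed_subset
    (hγ.preimage_isClosed_of_isClosed isClosed_Icc hA) inter_subset_left
  obtain ⟨t, ht⟩ := hK.exists_isLeast ⟨L, ⟨hL.le, le_rfl⟩, hb⟩
  have htI : t ∈ Icc 0 L := ht.1.1
  have h0t : 0 < t := lt_of_le_of_ne htI.1 (by rintro rfl; exact ha ht.1.2)
  have hsub : Icc 0 t ⊆ Icc 0 L := Icc_subset_Icc le_rfl htI.2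
  refine ⟨γ t, ht.1.2, γ '' Icc 0 t, image_mono hsub,
    isArc_image_Icc h0t (hγ.mono hsub) (hinj.mono hsub), ?_⟩
  rintro _ ⟨hxA, s, hs, rfl⟩
  have := ht.2 ⟨hsub hs, hxA⟩
  rw [mem_singleton_iff, le_antisymm hs.2 this]

theorem IsArcConnected.union_isArc {A S : Set X} (hA : IsClosed A) (hAc : IsArcConnected A)
    {a b : X} (hS : IsArc S a b) (hne : (A ∩ S).Nonempty) : IsArcConnected (A ∪ S) := by
  obtain ⟨e, heA, heS⟩ := hne
  have main : ∀ x ∈ A, ∀ y ∈ S, x ≠ y → ∃ B ⊆ A ∪ S, IsArc B x y := by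
    intro x hx y hy hxy
    by_cases hyA : y ∈ A
    · obtain ⟨B, hB, h⟩ := hAc x hx y hyA hxy
      exact ⟨B, hB.trans subset_union_left, h⟩
    · obtain ⟨D, hDS, hD⟩ := hS.isArcConnected y hy e heS (fun h => hyA (h ▸ heA))
      obtain ⟨c, hcA, B, hBD, hB, hAB⟩ := hD.exists_subarc_inter_eq hA hyA heA
      have hBS : B ⊆ A ∪ S := (hBD.trans hDS).trans subset_union_right
      by_cases hxc : x = c
      · subst hxc
        exact ⟨B, hBS, hB.symm⟩
      · obtain ⟨E, hE, h⟩ := hAc x hx c hcA hxc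
        exact ⟨E ∪ B, union_subset (hE.trans subset_union_left) hBS,
          h.union hB.symm ((inter_subset_inter_left _ hE).trans hAB)⟩
  rintro x (hx | hx) y (hy | hy) hxy
  · obtain ⟨B, hB, h⟩ := hAc x hx y hy hxy
    exact ⟨B, hB.trans subset_union_left, h⟩
  · exact main x hx y hy hxy
  · obtain ⟨B, hB, h⟩ := main y hy x hx hxy.symm
    exact ⟨B, hB, h.symm⟩
  · obtain ⟨B, hB, h⟩ := hS.isArcConnected x hx y hy hxy
    exact ⟨B, hB.trans subset_union_right, h⟩

end Arc

section JordanCurve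

variable {X : Type*} [TopologicalSpace X]

/-- A function which is discrete-valued on a compact set of reals and takes different values at
two of its points jumps across a gap of the set. -/
theorem exists_gap_of_ne {K : Set ℝ} (hK : IsCompact K) {m : ℝ → ℂ} (hm : ContinuousOn m K)
    {ε : ℝ} (hε : 0 < ε) (hdisc : ∀ s ∈ K, ∀ t ∈ K, m s ≠ m t → ε ≤ dist (m s) (m t))
    {s t : ℝ} (hs : s ∈ K) (ht : t ∈ K) (hst : s < t) (hne : m s ≠ m t) :
    ∃ u ∈ K, ∃ v ∈ K, u < v ∧ m u ≠ m v ∧ ∀ w ∈ K, ¬ (u < w ∧ w < v) := by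
  have hK1 : IsCompact (K ∩ m ⁻¹' {m s} ∩ Iic t) :=
    (hK.of_isClosed_subset (hm.preimage_isClosed_of_isClosed hK.isClosed isClosed_singleton)
      inter_subset_left).inter_right isClosed_Iic
  obtain ⟨u, hu⟩ := hK1.exists_isGreatest ⟨s, ⟨hs, rfl⟩, hst.le⟩
  have hus : m u = m s := hu.1.1.2
  have hK2 : IsCompact (K ∩ m ⁻¹' (ball (m s) ε)ᶜ ∩ Ici u) :=
    (hK.of_isClosed_subset (hm.preimage_isClosed_of_isClosed hK.isClosed isOpen_ball.isClosed_compl)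
      inter_subset_left).inter_right isClosed_Ici
  have hmem : ∀ w ∈ K, m w ≠ m s → m w ∈ (ball (m s) ε)ᶜ := fun w hw h => by
    simpa using hdisc w hw s hs h
  obtain ⟨v, hv⟩ := hK2.exists_isLeast ⟨t, ⟨ht, hmem t ht hne.symm⟩, hu.1.2⟩
  have hvne : m v ≠ m s := by
    intro h
    have := hv.1.1.2
    rw [mem_preimage, h] at this
    exact this (mem_ball_self hε)
  have huv : u < v := lt_of_le_of_ne hv.1.2 (by rintro rfl; exact hvne hus)
  have hvt : v ≤ t := hv.2 ⟨⟨ht, hmem t ht hne.symm⟩, hu.1.2⟩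
  refine ⟨u, hu.1.1.1, v, hv.1.1.1, huv, by rw [hus]; exact hvne.symm, ?_⟩
  rintro w hw ⟨huw, hwv⟩
  by_cases h : m w = m s
  · exact absurd (hu.2 ⟨⟨hw, h⟩, hwv.le.trans hvt⟩) (not_le.2 huw)
  · exact absurd (hv.2 ⟨⟨hw, hmem w hw h⟩, huw.le⟩) (not_le.2 hwv)

theorem two_pi_le_dist_of_exp_eq {x y : ℂ} (h : Complex.exp x = Complex.exp y) (hne : x ≠ y) :
    2 * π ≤ dist x y := by
  obtain ⟨n, hn⟩ := Complex.exp_eq_exp_iff_exists_int.1 h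
  have hn0 : n ≠ 0 := by
    rintro rfl
    exact hne (by simpa using hn)
  have h1 : (1 : ℝ) ≤ |(n : ℝ)| := by exact_mod_cast Int.one_le_abs hn0
  rw [hn, dist_eq_norm, add_sub_cancel_left]
  simp only [norm_mul, Complex.norm_intCast, Complex.norm_I, mul_one, Complex.norm_real,
    Complex.norm_ofNat, Real.norm_eq_abs, abs_of_pos Real.pi_pos]
  nlinarith [Real.pi_pos]

/-- If a function has a logarithm on an arc-connected compact set `A` but not on its union with
an arc, then the union contains a Jordan curve on which there is no logarithm. -/
theorem exists_circle_not_hasLogOn_of_union [T2Space X] {A S : Set X} (hA : IsCompact A)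
    (hAc : IsArcConnected A) {a b : X} (hS : IsArc S a b) {f : X → ℂ}
    (hf : ContinuousOn f S) (h0 : ∀ x ∈ S, f x ≠ 0) (hne : (A ∩ S).Nonempty)
    (hAlog : HasLogOn f A) (hno : ¬ HasLogOn f (A ∪ S)) :
    ∃ T ⊆ A ∪ S, Nonempty (↥T ≃ₜ Circle) ∧ ¬ HasLogOn f T := by
  obtain ⟨h, hh, hhf⟩ := hS.hasLogOn hf h0
  have hSclosed := hS.isCompact.isClosed
  obtain ⟨g, hg, hgf⟩ := hAlog
  obtain ⟨L, γ, hL, hγ, hinj, hSeq, -, -⟩ := hS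
  have hγS : ∀ t ∈ Icc 0 L, γ t ∈ S := fun t ht => hSeq ▸ mem_image_of_mem _ ht
  let K := Icc 0 L ∩ γ ⁻¹' A
  have hK : IsCompact K := isCompact_Icc.of_isClosed_subset
    (hγ.preimage_isClosed_of_isClosed isClosed_Icc hA.isClosed) inter_subset_left
  let m : ℝ → ℂ := fun t => g (γ t) - h (γ t)
  have hm : ContinuousOn m K :=
    (hg.comp (hγ.mono inter_subset_left) fun t ht => ht.2).sub
      (hh.comp (hγ.mono inter_subset_left) fun t ht => hγS t ht.1)
  have hexp : ∀ t ∈ K, Complex.exp (m t) = 1 := by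
    intro t ht
    rw [Complex.exp_sub, hgf _ ht.2, hhf _ (hγS t ht.1), div_self (h0 _ (hγS t ht.1))]
  have hdisc : ∀ s ∈ K, ∀ t ∈ K, m s ≠ m t → 2 * π ≤ dist (m s) (m t) := fun s hs t ht hst =>
    two_pi_le_dist_of_exp_eq ((hexp s hs).trans (hexp t ht).symm) hst
  obtain ⟨s, hs, t, ht, hst, hmst⟩ : ∃ s ∈ K, ∃ t ∈ K, s < t ∧ m s ≠ m t := by
    by_contra! hcon
    apply hno
    obtain ⟨e, heA, heS⟩ := hne
    obtain ⟨u, hu, rfl⟩ := hSeq.symm ▸ heS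
    have hconst : ∀ t ∈ K, m t = m u := by
      intro t ht
      rcases lt_trichotomy t u with hlt | rfl | hlt
      · exact hcon t ht u ⟨hu, heA⟩ hlt
      · rfl
      · exact (hcon u ⟨hu, heA⟩ t ht hlt).symm
    classical
    let k : X → ℂ := A.piecewise g (fun x => h x + m u)
    have hkA : EqOn k g A := piecewise_eqOn _ _ _
    have hkS : EqOn k (fun x => h x + m u) S := by
      intro x hx
      by_cases hxA : x ∈ A
      · obtain ⟨t, ht, rfl⟩ := hSeq.symm ▸ hx
        rw [hkA hxA]
        simp only [← hconst t ⟨ht, hxA⟩, m]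
        ring
      · exact piecewise_eq_of_notMem _ _ _ hxA
    refine ⟨k, ContinuousOn.union_of_isClosed (hg.congr hkA)
      ((hh.add continuousOn_const).congr hkS) hA.isClosed hSclosed, ?_⟩
    rintro x (hx | hx)
    · rw [hkA hx, hgf x hx]
    · rw [hkS hx, Complex.exp_add, hhf x hx, hexp u ⟨hu, heA⟩, mul_one]
  obtain ⟨u, hu, v, hv, huv, hmuv, hgap⟩ :=
    exists_gap_of_ne hK hm Real.two_pi_pos hdisc hs ht hst hmst
  have hsub : Icc u v ⊆ Icc 0 L := Icc_subset_Icc hu.1.1 hv.1.2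
  have harc : IsArc (γ '' Icc u v) (γ u) (γ v) :=
    isArc_image_Icc huv (hγ.mono hsub) (hinj.mono hsub)
  have hne' : γ v ≠ γ u := fun h => huv.ne' (hinj hv.1 hu.1 h)
  obtain ⟨B, hBA, hB⟩ := hAc (γ v) hv.2 (γ u) hu.2 hne'
  have hIS : γ '' Icc u v ⊆ S := by
    rintro _ ⟨w, hw, rfl⟩
    exact hγS w (hsub hw)
  refine ⟨γ '' Icc u v ∪ B, union_subset (hIS.trans subset_union_right)
    (hBA.trans subset_union_left), harc.homeomorph_circle hB ?_, ?_⟩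
  · rintro _ ⟨⟨w, hw, rfl⟩, hwB⟩
    have := hgap w ⟨hsub hw, hBA hwB⟩
    rcases hw.1.eq_or_lt with rfl | h1
    · exact Or.inl rfl
    · rcases hw.2.eq_or_lt with rfl | h2
      · exact Or.inr rfl
      · exact absurd ⟨h1, h2⟩ this
  · rintro ⟨k, hk, hkf⟩
    have e1 := hB.isPreconnected.sub_eq_sub_of_exp_eq (hk.mono subset_union_right) (hg.mono hBA)
      (fun x hx => (hkf x (Or.inr hx)).trans (hgf x (hBA hx)).symm) hB.right_mem hB.left_mem
    have e2 := harc.isPreconnected.sub_eq_sub_of_exp_eq (hk.mono subset_union_left) (hh.mono hIS)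
      (fun x hx => (hkf x (Or.inl hx)).trans (hhf x (hIS hx)).symm) harc.left_mem harc.right_mem
    apply hmuv
    simp only [m]
    linear_combination e2 - e1

/-- A nonvanishing function has a logarithm on any proper subset of a Jordan curve. -/
theorem hasLogOn_of_ssubset_circle {T F : Set X} (e : ↥T ≃ₜ Circle) {f : X → ℂ}
    (hf : ContinuousOn f T) (h0 : ∀ x ∈ T, f x ≠ 0) (hFT : F ⊆ T) {y : X} (hyT : y ∈ T)
    (hyF : y ∉ F) : HasLogOn f F := by
  let c : Circle := e ⟨y, hyT⟩
  let k : ℝ → T := fun t => e.symm (c * (Circle.exp π * Circle.exp t))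
  have hk : Continuous k := by fun_prop
  obtain ⟨G, hG, hGf⟩ := exists_log_of_simplyConnected
    (f := fun t : ℝ => f (k t)) ((continuousOn_iff_continuous_domRestrict.1 hf).comp hk)
    (fun t => h0 _ (k t).2)
  let r : T → Circle := fun x => (Circle.exp π)⁻¹ * (c⁻¹ * e x)
  have hr : Continuous r := by fun_prop
  have hkr : ∀ x : T, k (Complex.arg (r x)) = x := by
    intro x
    simp only [k, Circle.exp_arg]
    simp only [r, mul_inv_cancel_left, e.symm_apply_apply]
  have hrs : ∀ x : T, (x : X) ∈ F → (r x : ℂ) ∈ Complex.slitPlane := by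
    intro x hx
    rw [Complex.mem_slitPlane_iff_arg]
    refine ⟨fun harg => ?_, Circle.coe_ne_zero _⟩
    have := hkr x
    rw [harg] at this
    have h2 : Circle.exp π * Circle.exp π = 1 := by
      rw [← Circle.exp_add, ← two_mul]; exact Circle.exp_two_pi
    simp only [k, h2, mul_one, c, e.symm_apply_apply] at this
    exact hyF (by rw [← this] at hx; exact hx)
  have hcont : Continuous fun x : F => G (Complex.arg (r ⟨x, hFT x.2⟩)) := by
    refine hG.comp (continuous_iff_continuousAt.2 fun x => ?_)
    exact (Complex.continuousAt_arg (hrs ⟨x, hFT x.2⟩ x.2)).comp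
      (f := fun x : F => (r ⟨x, hFT x.2⟩ : ℂ)) (by fun_prop)
  classical
  refine ⟨fun x => if hx : x ∈ T then G (Complex.arg (r ⟨x, hx⟩)) else 0, ?_, ?_⟩
  · rw [continuousOn_iff_continuous_domRestrict]
    refine hcont.congr fun x => ?_
    simp [hFT x.2]
  · intro x hx
    simp only [dif_pos (hFT hx), hGf, hkr]

end JordanCurve

section Segment

variable {X : Type*} [TopologicalSpace X]

/-- A possibly degenerate arc from `a` to `b`. -/
def IsArcOrPoint (S : Set X) (a b : X) : Prop :=
  IsArc S a b ∨ a = b ∧ S = {a}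

theorem IsArcOrPoint.left_mem {S : Set X} {a b : X} (h : IsArcOrPoint S a b) : a ∈ S := by
  rcases h with h | ⟨-, rfl⟩
  · exact h.left_mem
  · rfl

theorem IsArcOrPoint.right_mem {S : Set X} {a b : X} (h : IsArcOrPoint S a b) : b ∈ S := by
  rcases h with h | ⟨rfl, rfl⟩
  · exact h.right_mem
  · rfl

theorem IsArcOrPoint.isCompact {S : Set X} {a b : X} (h : IsArcOrPoint S a b) : IsCompact S := by
  rcases h with h | ⟨-, rfl⟩
  · exact h.isCompact
  · exact isCompact_singleton

theorem IsArcOrPoint.isPreconnected {S : Set X} {a b : X} (h : IsArcOrPoint S a b) :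
    IsPreconnected S := by
  rcases h with h | ⟨-, rfl⟩
  · exact h.isPreconnected
  · exact isPreconnected_singleton

theorem IsArcOrPoint.hasLogOn [T2Space X] {S : Set X} {a b : X} (h : IsArcOrPoint S a b)
    {f : X → ℂ} (hf : ContinuousOn f S) (h0 : ∀ x ∈ S, f x ≠ 0) : HasLogOn f S := by
  rcases h with h | ⟨-, rfl⟩
  · exact h.hasLogOn hf h0
  · refine (hasLogOn_const (h0 a rfl) {a}).congr fun x hx => ?_
    rw [mem_singleton_iff.1 hx]

theorem IsArcOrPoint.isArcConnected {S : Set X} {a b : X} (h : IsArcOrPoint S a b) :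
    IsArcConnected S := by
  rcases h with h | ⟨-, rfl⟩
  · exact h.isArcConnected
  · intro x hx y hy hxy
    exact absurd ((mem_singleton_iff.1 hx).trans (mem_singleton_iff.1 hy).symm) hxy

theorem IsArcConnected.union_isArcOrPoint {A S : Set X} (hA : IsClosed A)
    (hAc : IsArcConnected A) {a b : X} (hS : IsArcOrPoint S a b) (hne : (A ∩ S).Nonempty) :
    IsArcConnected (A ∪ S) := by
  rcases hS with h | ⟨-, rfl⟩
  · exact hAc.union_isArc hA h hne
  · obtain ⟨x, hxA, hx⟩ := hne
    rw [mem_singleton_iff.1 hx] at hxA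
    rwa [union_singleton, insert_eq_of_mem hxA]

theorem exists_circle_not_hasLogOn_of_union' [T2Space X] {A S : Set X} (hA : IsCompact A)
    (hAc : IsArcConnected A) {a b : X} (hS : IsArcOrPoint S a b) {f : X → ℂ}
    (hf : ContinuousOn f S) (h0 : ∀ x ∈ S, f x ≠ 0) (hne : (A ∩ S).Nonempty)
    (hAlog : HasLogOn f A) (hno : ¬ HasLogOn f (A ∪ S)) :
    ∃ T ⊆ A ∪ S, Nonempty (↥T ≃ₜ Circle) ∧ ¬ HasLogOn f T := by
  rcases hS with h | ⟨-, rfl⟩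
  · exact exists_circle_not_hasLogOn_of_union hA hAc h hf h0 hne hAlog hno
  · obtain ⟨x, hxA, hx⟩ := hne
    rw [mem_singleton_iff.1 hx] at hxA
    rw [union_singleton, insert_eq_of_mem hxA] at hno
    exact absurd hAlog hno

/-- A triangle on which a nonvanishing function has no logarithm contains a Jordan curve on which
it has no logarithm. -/
theorem exists_circle_not_hasLogOn_of_triangle [T2Space X] {S₁ S₂ S₃ : Set X} {x y z : X}
    (h₁ : IsArcOrPoint S₁ z x) (h₂ : IsArcOrPoint S₂ x y) (h₃ : IsArcOrPoint S₃ z y) {f : X → ℂ}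
    (hf : ContinuousOn f (S₁ ∪ S₂ ∪ S₃)) (h0 : ∀ x ∈ S₁ ∪ S₂ ∪ S₃, f x ≠ 0)
    (hno : ¬ HasLogOn f (S₁ ∪ S₂ ∪ S₃)) :
    ∃ T ⊆ S₁ ∪ S₂ ∪ S₃, Nonempty (↥T ≃ₜ Circle) ∧ ¬ HasLogOn f T := by
  have hsub₁ : S₁ ⊆ S₁ ∪ S₂ ∪ S₃ := subset_union_left.trans subset_union_left
  have hsub₂ : S₂ ⊆ S₁ ∪ S₂ ∪ S₃ := subset_union_right.trans subset_union_left
  have hne : (S₁ ∩ S₂).Nonempty := ⟨x, h₁.right_mem, h₂.left_mem⟩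
  by_cases hA : HasLogOn f (S₁ ∪ S₂)
  · exact exists_circle_not_hasLogOn_of_union' (h₁.isCompact.union h₂.isCompact)
      (h₁.isArcConnected.union_isArcOrPoint h₁.isCompact.isClosed h₂ hne) h₃
      (hf.mono subset_union_right) (fun w hw => h0 w (Or.inr hw))
      ⟨z, Or.inl h₁.left_mem, h₃.left_mem⟩ hA hno
  · obtain ⟨T, hT, h⟩ := exists_circle_not_hasLogOn_of_union' h₁.isCompact h₁.isArcConnected h₂
      (hf.mono hsub₂) (fun w hw => h0 w (hsub₂ hw)) hne
      (h₁.hasLogOn (hf.mono hsub₁) fun w hw => h0 w (hsub₁ hw)) hA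
    exact ⟨T, hT.trans subset_union_left, h⟩

end Segment

section Geodesic

variable {Z : Type*} [MetricSpace Z]

theorem IsGeodesicSpace.exists_segment [MeasurableSpace Z] [BorelSpace Z]
    (hgeo : IsGeodesicSpace Z) (x y : Z) :
    ∃ S : Set Z, IsArcOrPoint S x y ∧ (∀ w ∈ S, dist x w ≤ dist x y) ∧
      μH[1] S ≤ ENNReal.ofReal (dist x y) := by
  obtain ⟨γ, h0, h1, hγ⟩ := hgeo x y
  have hlip : LipschitzOnWith 1 γ (Icc 0 (dist x y)) :=
    LipschitzOnWith.of_dist_le_mul fun s hs t ht => by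
      rw [hγ s hs t ht, Real.dist_eq]; simp
  refine ⟨γ '' Icc 0 (dist x y), ?_, ?_, ?_⟩
  · rcases (dist_nonneg (x := x) (y := y)).eq_or_lt with h | h
    · refine Or.inr ⟨dist_eq_zero.1 h.symm, ?_⟩
      rw [← h, Icc_self, image_singleton, h0]
    · refine Or.inl ⟨_, γ, h, hlip.continuousOn, ?_, rfl, h0, h1⟩
      intro s hs t ht hst
      have := hγ s hs t ht
      rw [hst, dist_self] at this
      exact sub_eq_zero.1 (abs_eq_zero.1 this.symm)
  · rintro _ ⟨t, ht, rfl⟩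
    have := hγ 0 ⟨le_rfl, dist_nonneg⟩ t ht
    rw [h0, zero_sub, abs_neg, abs_of_nonneg ht.1] at this
    rw [this]
    exact ht.2
  · refine (hlip.hausdorffMeasure_image_le zero_le_one).trans ?_
    simp [hausdorffMeasure_real]

theorem IsGeodesicSpace.isPreconnected_ball (hgeo : IsGeodesicSpace Z) (z : Z) (r : ℝ) :
    IsPreconnected (ball z r) := by
  let _ : MeasurableSpace Z := borel Z
  have : BorelSpace Z := ⟨rfl⟩
  rcases le_or_gt r 0 with hr | hr
  · rw [ball_eq_empty.2 hr]; exact isPreconnected_empty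
  · refine isPreconnected_of_forall z fun y hy => ?_
    obtain ⟨S, hS, hd, -⟩ := hgeo.exists_segment z y
    exact ⟨S, fun w hw => by
      rw [mem_ball'] at hy ⊢; exact (hd w hw).trans_lt hy, hS.left_mem, hS.right_mem,
      hS.isPreconnected⟩

/-- In a geodesic space, a nonvanishing function without logarithm on a ball of radius `r` has no
logarithm on some Jordan curve of length less than `2 * r` in the ball. -/
theorem IsGeodesicSpace.exists_short_circle [MeasurableSpace Z] [BorelSpace Z]
    (hgeo : IsGeodesicSpace Z) {z : Z} {r : ℝ} {f : Z → ℂ} (hf : ContinuousOn f (ball z r))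
    (h0 : ∀ x ∈ ball z r, f x ≠ 0) (hno : ¬ HasLogOn f (ball z r)) :
    ∃ T ⊆ ball z r, Nonempty (↥T ≃ₜ Circle) ∧ ¬ HasLogOn f T ∧
      μH[1] T < ENNReal.ofReal (2 * r) := by
  by_contra! hcon
  apply hno
  rcases le_or_gt r 0 with hr | hr
  · rw [ball_eq_empty.2 hr]
    exact ⟨fun _ => 0, continuousOn_empty _, fun x hx => absurd hx (notMem_empty x)⟩
  choose S hS hSd hSμ using hgeo.exists_segment
  have hSz : ∀ x ∈ ball z r, S z x ⊆ ball z r := fun x hx w hw => by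
    rw [mem_ball'] at hx ⊢; exact (hSd z x w hw).trans_lt hx
  have htri : ∀ x ∈ ball z r, ∀ y, dist x y < r - dist z x →
      S z x ∪ S x y ∪ S z y ⊆ ball z r ∧ HasLogOn f (S z x ∪ S x y ∪ S z y) := by
    intro x hx y hxy
    have htr := dist_triangle z x y
    have hy : y ∈ ball z r := by
      rw [mem_ball']; linarith
    have hsub : S z x ∪ S x y ∪ S z y ⊆ ball z r := by
      refine union_subset (union_subset (hSz x hx) fun w hw => ?_) (hSz y hy)
      have h1 := hSd x y w hw
      have h2 := dist_triangle z x w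
      rw [mem_ball']; linarith
    refine ⟨hsub, ?_⟩
    by_contra hlog
    obtain ⟨T, hT, hc, hTlog⟩ := exists_circle_not_hasLogOn_of_triangle (hS z x) (hS x y) (hS z y)
      (hf.mono hsub) (fun w hw => h0 w (hsub hw)) hlog
    refine absurd (hcon T (hT.trans hsub) hc hTlog) (not_le.2 ?_)
    calc μH[1] T ≤ μH[1] (S z x ∪ S x y ∪ S z y) := measure_mono hT
      _ ≤ μH[1] (S z x) + μH[1] (S x y) + μH[1] (S z y) :=
        (measure_union_le _ _).trans (add_le_add_left (measure_union_le _ _) _)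
      _ ≤ ENNReal.ofReal (dist z x) + ENNReal.ofReal (dist x y) + ENNReal.ofReal (dist z y) :=
        add_le_add (add_le_add (hSμ _ _) (hSμ _ _)) (hSμ _ _)
      _ = ENNReal.ofReal (dist z x + dist x y + dist z y) := by
        rw [ENNReal.ofReal_add (by positivity) (by positivity),
          ENNReal.ofReal_add (by positivity) (by positivity)]
      _ < ENNReal.ofReal (2 * r) := (ENNReal.ofReal_lt_ofReal_iff (by positivity)).2 (by linarith)
  have hz : z ∈ ball z r := mem_ball_self hr
  have hlift : ∀ x, ∃ h : Z → ℂ, x ∈ ball z r → ContinuousOn h (S z x) ∧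
      (∀ w ∈ S z x, Complex.exp (h w) = f w) ∧ h z = Complex.log (f z) := by
    intro x
    by_cases hx : x ∈ ball z r
    · obtain ⟨h, hh, hhf⟩ := (hS z x).hasLogOn (hf.mono (hSz x hx)) fun w hw => h0 w (hSz x hx hw)
      refine ⟨fun w => h w + (Complex.log (f z) - h z), fun _ =>
        ⟨hh.add continuousOn_const, fun w hw => ?_, by ring⟩⟩
      rw [Complex.exp_add, Complex.exp_sub, Complex.exp_log (h0 z hz), hhf z (hS z x).left_mem,
        div_self (h0 z hz), mul_one, hhf w hw]
    · exact ⟨0, fun h => absurd h hx⟩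
  choose h hh using hlift
  refine ⟨fun x => h x x, fun x hx => ContinuousAt.continuousWithinAt ?_, fun x hx =>
    (hh x hx).2.1 x (hS z x).right_mem⟩
  have hfx : ContinuousAt f x := hf.continuousAt (isOpen_ball.mem_nhds hx)
  have hdiv : ContinuousAt (fun y => f y / f x) x := hfx.div_const _
  have hone : f x / f x = 1 := div_self (h0 x hx)
  have hslit : ∀ᶠ y in nhds x, f y / f x ∈ Complex.slitPlane :=
    hdiv.eventually_mem (Complex.isOpen_slitPlane.mem_nhds (by
      rw [hone]; exact Complex.one_mem_slitPlane))
  obtain ⟨δ, hδ, hball⟩ := Metric.eventually_nhds_iff_ball.1 hslit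
  have hrx : 0 < r - dist z x := by rw [mem_ball'] at hx; linarith
  have heq : ∀ y ∈ ball x (min δ (r - dist z x)),
      h y y = h x x + Complex.log (f y / f x) := by
    intro y hy
    rw [mem_ball', lt_min_iff] at hy
    obtain ⟨hsub, k, hk, hkf⟩ := htri x hx y hy.2
    have hyr : y ∈ ball z r := hsub (Or.inr (hS z y).right_mem)
    have e1 := (hS z x).isPreconnected.sub_eq_sub_of_exp_eq
      (hk.mono (subset_union_left.trans subset_union_left)) (hh x hx).1
      (fun w hw => (hkf w (Or.inl (Or.inl hw))).trans ((hh x hx).2.1 w hw).symm)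
      (hS z x).left_mem (hS z x).right_mem
    have e2 := (hS z y).isPreconnected.sub_eq_sub_of_exp_eq
      (hk.mono subset_union_right) (hh y hyr).1
      (fun w hw => (hkf w (Or.inr hw)).trans ((hh y hyr).2.1 w hw).symm)
      (hS z y).left_mem (hS z y).right_mem
    have hSxy : S x y ⊆ ball z r :=
      (subset_union_right.trans subset_union_left).trans hsub
    have hmem : ∀ w ∈ S x y, f w / f x ∈ Complex.slitPlane := fun w hw =>
      hball w (by rw [mem_ball']; exact (hSd x y w hw).trans_lt hy.1)
    have e3 := (hS x y).isPreconnected.sub_eq_sub_of_exp_eq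
      (hk.mono (subset_union_right.trans subset_union_left))
      (h := fun w => k x + Complex.log (f w / f x))
      (continuousOn_const.add (((hf.mono hSxy).div_const _).clog hmem))
      (fun w hw => by
        rw [Complex.exp_add, Complex.exp_log (Complex.slitPlane_ne_zero (hmem w hw)),
          hkf x (Or.inl (Or.inl (hS z x).right_mem)), hkf w (Or.inl (Or.inr hw)),
          mul_div_cancel₀ _ (h0 x hx)])
      (hS x y).left_mem (hS x y).right_mem
    rw [(hh x hx).2.2] at e1
    rw [(hh y hyr).2.2] at e2
    simp only [hone, Complex.log_one] at e3
    linear_combination e2 - e1 - e3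
  have hcont : ContinuousAt (fun y => h x x + Complex.log (f y / f x)) x :=
    continuousAt_const.add (hdiv.clog (by rw [hone]; exact Complex.one_mem_slitPlane))
  refine hcont.congr ?_
  filter_upwards [ball_mem_nhds x (lt_min hδ hrx)] with y hy
  exact (heq y hy).symm

end Geodesic

/-- The closed square `[0, n] × [0, n]` in the complex plane. -/
def planeSquare (n : ℝ) : Set ℂ :=
  {w | 0 ≤ w.re ∧ w.re ≤ n ∧ 0 ≤ w.im ∧ w.im ≤ n}

/-- A parametrization of `Z` by the square `[0, n] × [0, n]`, under which `bdry` corresponds to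
the boundary of the square. -/
structure SquareChart (Z : Type*) [TopologicalSpace Z] (bdry : Set Z) (n : ℝ) where
  /-- the coordinate map -/
  toFun : Z → ℂ
  /-- the parametrization, extended to the plane -/
  param : ℂ → Z
  continuous_toFun : Continuous toFun
  continuous_param : Continuous param
  param_toFun : ∀ x, param (toFun x) = x
  toFun_mem : ∀ x, toFun x ∈ planeSquare n
  toFun_param : ∀ w ∈ planeSquare n, toFun (param w) = w
  mem_bdry : ∀ x, x ∈ bdry ↔ (toFun x).re = 0 ∨ (toFun x).re = n ∨
    (toFun x).im = 0 ∨ (toFun x).im = n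

theorem isClosed_planeSquare (n : ℝ) : IsClosed (planeSquare n) := by
  have : planeSquare n = (Complex.re ⁻¹' Icc 0 n) ∩ (Complex.im ⁻¹' Icc 0 n) := by
    ext w; simp [planeSquare, and_assoc]
  rw [this]
  exact (isClosed_Icc.preimage Complex.continuous_re).inter
    (isClosed_Icc.preimage Complex.continuous_im)

theorem isBounded_planeSquare (n : ℝ) : Bornology.IsBounded (planeSquare n) := by
  refine (Metric.isBounded_iff_subset_closedBall 0).2 ⟨n + n, fun w hw => ?_⟩
  obtain ⟨h1, h2, h3, h4⟩ := hw
  rw [mem_closedBall_zero_iff]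
  refine (Complex.norm_le_abs_re_add_abs_im w).trans ?_
  rw [abs_of_nonneg h1, abs_of_nonneg h3]
  linarith

namespace SquareChart

variable {Z : Type*} [TopologicalSpace Z] {bdry : Set Z} {n : ℝ} (Φ : SquareChart Z bdry n)

theorem injective_toFun : Function.Injective Φ.toFun := fun x y h => by
  rw [← Φ.param_toFun x, h, Φ.param_toFun]

/-- A boundary point of the square is not enclosed by any subset of the square. -/
theorem hasLogOn_of_mem_bdry {q : Z} (hq : q ∈ bdry) {T : Set Z} (hqT : q ∉ T) :
    HasLogOn (fun x => Φ.toFun x - Φ.toFun q) T := by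
  have hne : ∀ x ∈ T, Φ.toFun x - Φ.toFun q ≠ 0 := fun x hx h =>
    hqT (Φ.injective_toFun (sub_eq_zero.1 h) ▸ hx)
  have main : ∀ c : ℂ, c ≠ 0 → (∀ x, 0 ≤ (c * (Φ.toFun x - Φ.toFun q)).re) →
      HasLogOn (fun x => Φ.toFun x - Φ.toFun q) T := by
    intro c hc hre
    have h1 : HasLogOn (fun x => c * (Φ.toFun x - Φ.toFun q)) T := by
      refine hasLogOn_of_mem_slitPlane
        (continuous_const.mul (Φ.continuous_toFun.sub continuous_const)).continuousOn ?_
      intro x hx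
      rw [Complex.mem_slitPlane_iff]
      rcases (hre x).eq_or_lt with h | h
      · exact Or.inr fun him => mul_ne_zero hc (hne x hx) (Complex.ext h.symm him)
      · exact Or.inl h
    refine ((hasLogOn_const (inv_ne_zero hc) T).mul h1).congr fun x _ => ?_
    simp only
    rw [inv_mul_cancel_left₀ hc]
  have hsq := fun x => Φ.toFun_mem x
  rcases (Φ.mem_bdry q).1 hq with h | h | h | h
  · exact main 1 one_ne_zero fun x => by simp [h, (hsq x).1]
  · exact main (-1) (by simp) fun x => by simp [h, (hsq x).2.1]
  · exact main (-Complex.I) (by simp) fun x => by simp [h, (hsq x).2.2.1]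
  · exact main Complex.I (by simp) fun x => by simp [h, (hsq x).2.2.2]

theorem image_eq_preimage_inter (Ω : Set Z) :
    Φ.toFun '' Ω = Φ.param ⁻¹' Ω ∩ planeSquare n := by
  ext w
  constructor
  · rintro ⟨x, hx, rfl⟩
    exact ⟨by rwa [mem_preimage, Φ.param_toFun], Φ.toFun_mem x⟩
  · rintro ⟨hw, hwQ⟩
    exact ⟨_, hw, Φ.toFun_param w hwQ⟩

/-- A point of an open set off the boundary is enclosed by the frontier of the set. -/
theorem not_hasLogOn_frontier {Ω : Set Z} (hΩ : IsOpen Ω) (hd : Disjoint Ω bdry) {p : Z}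
    (hp : p ∈ Ω) : ¬ HasLogOn (fun x => Φ.toFun x - Φ.toFun p) (frontier Ω) := by
  intro h
  have hopen : IsOpen (Φ.toFun '' Ω) := by
    have : Φ.toFun '' Ω = Φ.param ⁻¹' Ω ∩
        ((Complex.re ⁻¹' Ioo 0 n) ∩ (Complex.im ⁻¹' Ioo 0 n)) := by
      rw [Φ.image_eq_preimage_inter]
      ext w
      constructor
      · rintro ⟨hw, hwQ⟩
        have hb : Φ.param w ∉ bdry := disjoint_left.1 hd hw
        rw [Φ.mem_bdry, Φ.toFun_param w hwQ] at hb
        push Not at hb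
        obtain ⟨h1, h2, h3, h4⟩ := hwQ
        exact ⟨hw, ⟨h1.lt_of_ne hb.1.symm, h2.lt_of_ne hb.2.1⟩,
          ⟨h3.lt_of_ne hb.2.2.1.symm, h4.lt_of_ne hb.2.2.2⟩⟩
      · rintro ⟨hw, h1, h2⟩
        exact ⟨hw, h1.1.le, h1.2.le, h2.1.le, h2.2.le⟩
    rw [this]
    exact (hΩ.preimage Φ.continuous_param).inter
      ((isOpen_Ioo.preimage Complex.continuous_re).inter
        (isOpen_Ioo.preimage Complex.continuous_im))
  have hsub : Φ.toFun '' Ω ⊆ planeSquare n := by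
    rw [Φ.image_eq_preimage_inter]; exact inter_subset_right
  have hfr : frontier (Φ.toFun '' Ω) ⊆ planeSquare n :=
    frontier_subset_closure.trans (closure_minimal hsub (isClosed_planeSquare n))
  refine _root_.not_hasLogOn_frontier ((isBounded_planeSquare n).subset hsub)
    (mem_image_of_mem _ hp) ?_
  refine (h.comp (e := Φ.param) Φ.continuous_param.continuousOn ?_).congr ?_
  · intro w hw
    have hwQ := hfr hw
    rw [hopen.frontier_eq] at hw
    rw [hΩ.frontier_eq]
    refine ⟨?_, fun hwΩ => hw.2 ?_⟩
    · have := image_closure_subset_closure_image Φ.continuous_param (mem_image_of_mem _ hw.1)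
      rwa [← image_comp, show Φ.param ∘ Φ.toFun = id from funext Φ.param_toFun, image_id] at this
    · rw [Φ.image_eq_preimage_inter]; exact ⟨hwΩ, hwQ⟩
  · intro w hw
    simp only [Φ.toFun_param w (hfr hw)]

/-- The component enclosed by a Jordan curve `T` is a Jordan domain with boundary `T`. -/
theorem jordan_domain [LocallyConnectedSpace Z] [T2Space Z] {T : Set Z}
    (e : ↥T ≃ₜ Circle) {p : Z} (hp : p ∉ T)
    (hno : ¬ HasLogOn (fun x => Φ.toFun x - Φ.toFun p) T) :
    IsOpen (connectedComponentIn Tᶜ p) ∧ IsConnected (connectedComponentIn Tᶜ p) ∧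
      frontier (connectedComponentIn Tᶜ p) = T ∧
      Disjoint (connectedComponentIn Tᶜ p) bdry := by
  have hTc : IsCompact T := isCompact_iff_compactSpace.2 e.symm.compactSpace
  have hTo : IsOpen Tᶜ := hTc.isClosed.isOpen_compl
  have hpT : p ∈ Tᶜ := hp
  set Ω := connectedComponentIn Tᶜ p with hΩdef
  have hΩ : IsOpen Ω := hTo.connectedComponentIn
  have hconn : IsConnected Ω := isConnected_connectedComponentIn_iff.2 hpT
  have hpΩ : p ∈ Ω := mem_connectedComponentIn hpT
  have hdisj : Disjoint Ω bdry := by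
    rw [disjoint_left]
    intro q hqΩ hqb
    have hqT : q ∉ T := connectedComponentIn_subset _ _ hqΩ
    refine hno (HasLogOn.of_isPreconnected Φ.continuous_toFun.continuousOn hTc
      (hconn.isPreconnected.image _ Φ.continuous_toFun.continuousOn) ?_
      (mem_image_of_mem _ hpΩ) (mem_image_of_mem _ hqΩ) (Φ.hasLogOn_of_mem_bdry hqb hqT))
    exact disjoint_image_of_injective Φ.injective_toFun
      (disjoint_left.2 fun x hx => connectedComponentIn_subset _ _ hx)
  have hfrT : frontier Ω ⊆ T := by
    rw [hΩ.frontier_eq]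
    rintro x ⟨hxcl, hxΩ⟩
    by_contra hxT
    have hx : x ∈ Tᶜ := hxT
    obtain ⟨y, hy1, hy2⟩ := mem_closure_iff.1 hxcl _ (hTo.connectedComponentIn (x := x))
      (mem_connectedComponentIn hx)
    have := connectedComponentIn_eq hy1
    rw [connectedComponentIn_eq hy2, ← this] at hΩdef
    exact hxΩ (hΩdef ▸ mem_connectedComponentIn hx)
  refine ⟨hΩ, hconn, hfrT.antisymm fun y hy => ?_, hdisj⟩
  by_contra hyF
  refine Φ.not_hasLogOn_frontier hΩ hdisj hpΩ (hasLogOn_of_ssubset_circle e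
    (Φ.continuous_toFun.sub continuous_const).continuousOn ?_ hfrT hy hyF)
  intro x hx h
  exact hp (Φ.injective_toFun (sub_eq_zero.1 h) ▸ hx)

end SquareChart

theorem IsGeodesicSpace.locallyConnectedSpace {Z : Type*} [MetricSpace Z]
    (hgeo : IsGeodesicSpace Z) : LocallyConnectedSpace Z :=
  locallyConnectedSpace_of_connected_bases (fun x r => ball x r) (fun _ r => 0 < r)
    (fun _ => nhds_basis_ball) fun x r _ => hgeo.isPreconnected_ball x r

/-- Under an isoperimetric inequality and a lower area growth bound, points far away from a ball
are not enclosed by the ball. -/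
theorem hasLogOn_ball_of_far {Z : Type*} [MetricSpace Z] [MeasurableSpace Z] [BorelSpace Z]
    (hgeo : IsGeodesicSpace Z) {bdry : Set Z} {n : ℝ} (Φ : SquareChart Z bdry n)
    {C l₀ : ℝ} (hC : 0 < C)
    (hisop : ∀ T Ω : Set Z, Nonempty (↥T ≃ₜ Circle) →
      IsOpen Ω → IsConnected Ω → frontier Ω = T → Disjoint Ω bdry →
      μH[1] T < ENNReal.ofReal l₀ →
      μH[2] Ω ≤ ENNReal.ofReal C * (μH[1] T) ^ 2)
    (hgrowth : ∀ (z : Z) (r : ℝ), 0 < r → Disjoint (Metric.ball z r) bdry →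
      min (ENNReal.ofReal (π ^ 2 / (64 * C) * r ^ 2)) (ENNReal.ofReal (C * l₀ ^ 2)) ≤
        μH[2] (Metric.ball z r))
    {z p : Z} {r s : ℝ} (hr : 0 < r) (hrl : 2 * r < l₀) (hs : 0 < s)
    (hp : r + s ≤ dist z p) (hsr : 16 * C * r < π * s) :
    HasLogOn (fun x => Φ.toFun x - Φ.toFun p) (ball z r) := by
  by_contra hno
  have hpr : p ∉ ball z r := by rw [mem_ball', not_lt]; linarith
  obtain ⟨T, hT, ⟨e⟩, hTlog, hTμ⟩ := hgeo.exists_short_circle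
    (f := fun x => Φ.toFun x - Φ.toFun p)
    (Φ.continuous_toFun.sub continuous_const).continuousOn
    (fun x hx h => by rw [Φ.injective_toFun (sub_eq_zero.1 h)] at hx; exact hpr hx) hno
  have := hgeo.locallyConnectedSpace
  obtain ⟨h1, h2, h3, h4⟩ := Φ.jordan_domain e (fun h => hpr (hT h)) hTlog
  have hsub : ball p s ⊆ connectedComponentIn Tᶜ p := by
    refine (hgeo.isPreconnected_ball p s).subset_connectedComponentIn (mem_ball_self hs) ?_
    intro x hx hxT
    have hxz := mem_ball'.1 (hT hxT)
    rw [mem_ball] at hx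
    linarith [dist_triangle z x p]
  have hA := hisop T _ ⟨e⟩ h1 h2 h3 h4
    (hTμ.trans_le (ENNReal.ofReal_le_ofReal hrl.le))
  have hB := hgrowth p s hs (h4.mono_left hsub)
  have hle : min (ENNReal.ofReal (π ^ 2 / (64 * C) * s ^ 2)) (ENNReal.ofReal (C * l₀ ^ 2)) ≤
      ENNReal.ofReal (C * (2 * r) ^ 2) := by
    refine hB.trans ((measure_mono hsub).trans (hA.trans ?_))
    rw [ENNReal.ofReal_mul hC.le, ENNReal.ofReal_pow (by positivity)]
    gcongr
  have hl : 0 < l₀ := by linarith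
  refine absurd hle (not_le.2 (lt_min ?_ ?_))
  · refine (ENNReal.ofReal_lt_ofReal_iff (by positivity)).2 ?_
    have h5 : (16 * C * r) ^ 2 < (π * s) ^ 2 := by
      gcongr
    rw [div_mul_eq_mul_div, lt_div_iff₀ (by positivity)]
    nlinarith
  · refine (ENNReal.ofReal_lt_ofReal_iff (mul_pos hC (pow_pos hl 2))).2 ?_
    gcongr

/-- The closed unit square of the plane with lower left corner `t`. -/
def gridTile (t : ℤ × ℤ) : Set ℂ :=
  {w | (t.1 : ℝ) ≤ w.re ∧ w.re ≤ t.1 + 1 ∧ (t.2 : ℝ) ≤ w.im ∧ w.im ≤ t.2 + 1}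

/-- The union of the tiles in `S`. -/
def gridUnion (S : Set (ℤ × ℤ)) : Set ℂ := ⋃ t : S, gridTile t

/-- Two tiles are adjacent if they share a side. -/
def GridAdj (t t' : ℤ × ℤ) : Prop :=
  (t.1 = t'.1 ∧ (t.2 = t'.2 + 1 ∨ t'.2 = t.2 + 1)) ∨
    (t.2 = t'.2 ∧ (t.1 = t'.1 + 1 ∨ t'.1 = t.1 + 1))

/-- The tiles which can be reached from the complement of `I` through tiles not in `B`. -/
inductive IsOuterTile (I B : Set (ℤ × ℤ)) : ℤ × ℤ → Prop
  | base {t : ℤ × ℤ} : t ∉ I → IsOuterTile I B t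
  | step {t t' : ℤ × ℤ} : t ∉ B → GridAdj t t' → IsOuterTile I B t' → IsOuterTile I B t

theorem mem_gridUnion {S : Set (ℤ × ℤ)} {w : ℂ} :
    w ∈ gridUnion S ↔ ∃ t ∈ S, w ∈ gridTile t := by
  simp [gridUnion]

theorem gridUnion_mono {S S' : Set (ℤ × ℤ)} (h : S ⊆ S') : gridUnion S ⊆ gridUnion S' :=
  fun w hw => by
    obtain ⟨t, ht, hwt⟩ := mem_gridUnion.1 hw
    exact mem_gridUnion.2 ⟨t, h ht, hwt⟩

theorem isClosed_gridTile (t : ℤ × ℤ) : IsClosed (gridTile t) := by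
  have : gridTile t = (Complex.re ⁻¹' Icc (t.1 : ℝ) (t.1 + 1)) ∩
      (Complex.im ⁻¹' Icc (t.2 : ℝ) (t.2 + 1)) := by
    ext w; simp [gridTile, and_assoc]
  rw [this]
  exact (isClosed_Icc.preimage Complex.continuous_re).inter
    (isClosed_Icc.preimage Complex.continuous_im)

theorem mem_gridTile_floor (w : ℂ) : w ∈ gridTile (⌊w.re⌋, ⌊w.im⌋) :=
  ⟨Int.floor_le _, (Int.lt_floor_add_one _).le, Int.floor_le _, (Int.lt_floor_add_one _).le⟩

theorem dist_le_of_mem_gridTile {t : ℤ × ℤ} {w w' : ℂ} (h : w ∈ gridTile t)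
    (h' : w' ∈ gridTile t) : dist w w' ≤ 2 := by
  obtain ⟨h1, h2, h3, h4⟩ := h
  obtain ⟨h1', h2', h3', h4'⟩ := h'
  rw [Complex.dist_eq]
  refine (Complex.norm_le_abs_re_add_abs_im _).trans ?_
  rw [Complex.sub_re, Complex.sub_im]
  have hre : |w.re - w'.re| ≤ 1 := abs_le.2 ⟨by linarith, by linarith⟩
  have him : |w.im - w'.im| ≤ 1 := abs_le.2 ⟨by linarith, by linarith⟩
  linarith

theorem locallyFinite_gridTile : LocallyFinite gridTile := by
  intro w
  refine ⟨ball w 1, ball_mem_nhds w one_pos, ?_⟩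
  refine ((finite_Icc (⌊w.re⌋ - 3) (⌊w.re⌋ + 3)).prod
    (finite_Icc (⌊w.im⌋ - 3) (⌊w.im⌋ + 3))).subset ?_
  rintro ⟨i, j⟩ ⟨x, ⟨h1, h2, h3, h4⟩, hx⟩
  rw [mem_ball, Complex.dist_eq] at hx
  have hre := (Complex.abs_re_le_norm (x - w)).trans_lt hx
  have him := (Complex.abs_im_le_norm (x - w)).trans_lt hx
  rw [Complex.sub_re, abs_lt] at hre
  rw [Complex.sub_im, abs_lt] at him
  have hf1 := Int.floor_le w.re
  have hf2 := Int.lt_floor_add_one w.re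
  have hf3 := Int.floor_le w.im
  have hf4 := Int.lt_floor_add_one w.im
  simp only at h1 h2 h3 h4
  refine ⟨⟨?_, ?_⟩, ?_, ?_⟩ <;> simp only <;>
  · rw [← Int.cast_le (R := ℝ)]
    push_cast
    linarith

theorem isClosed_gridUnion (S : Set (ℤ × ℤ)) : IsClosed (gridUnion S) :=
  (locallyFinite_gridTile.comp_injective Subtype.val_injective).isClosed_iUnion
    fun t => isClosed_gridTile t

theorem IsOuterTile.of_mem_gridTile {I B : Set (ℤ × ℤ)} {t t' : ℤ × ℤ} (h : IsOuterTile I B t)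
    {w : ℂ} (hw : w ∈ gridTile t) (hw' : w ∈ gridTile t') (hB : w ∉ gridUnion B) :
    IsOuterTile I B t' := by
  have hnB : ∀ s, w ∈ gridTile s → s ∉ B := fun s hs hsB => hB (mem_gridUnion.2 ⟨s, hsB, hs⟩)
  obtain ⟨i, j⟩ := t
  obtain ⟨i', j'⟩ := t'
  obtain ⟨h1, h2, h3, h4⟩ := hw
  obtain ⟨h1', h2', h3', h4'⟩ := hw'
  simp only at h1 h2 h3 h4 h1' h2' h3' h4'
  have hi1 : i ≤ i' + 1 := by rw [← Int.cast_le (R := ℝ)]; push_cast; linarith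
  have hi2 : i' ≤ i + 1 := by rw [← Int.cast_le (R := ℝ)]; push_cast; linarith
  have hj1 : j ≤ j' + 1 := by rw [← Int.cast_le (R := ℝ)]; push_cast; linarith
  have hj2 : j' ≤ j + 1 := by rw [← Int.cast_le (R := ℝ)]; push_cast; linarith
  have hmid : IsOuterTile I B (i', j) := by
    by_cases hii : i' = i
    · rwa [hii]
    · exact .step (t' := (i, j)) (hnB _ ⟨h1', h2', h3, h4⟩)
        (Or.inr ⟨rfl, by simp only; omega⟩) h
  by_cases hjj : j' = j
  · rwa [hjj]
  · exact .step (t' := (i', j)) (hnB _ ⟨h1', h2', h3', h4'⟩)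
      (Or.inl ⟨rfl, by simp only; omega⟩) hmid

/-- A point of a tile which is not outer is enclosed by the tiles of `B`. -/
theorem not_hasLogOn_gridUnion {I B : Set (ℤ × ℤ)} (hI : I.Finite) {t : ℤ × ℤ}
    (ht : ¬ IsOuterTile I B t) {p : ℂ} (hp : p ∈ gridTile t) (hpB : p ∉ gridUnion B) :
    ¬ HasLogOn (fun w => w - p) (gridUnion B) := by
  intro hlog
  set P : Set (ℤ × ℤ) := {t | ¬ IsOuterTile I B t}
  have hPI : P ⊆ I := fun s hs => not_not.1 fun h => hs (.base h)
  set O := (gridUnion B)ᶜ ∩ gridUnion P with hO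
  have hO' : O = (gridUnion B)ᶜ ∩ (gridUnion Pᶜ)ᶜ := by
    ext w
    refine and_congr_right fun hw => ⟨fun h h' => ?_, fun h => ?_⟩
    · obtain ⟨s, hs, hws⟩ := mem_gridUnion.1 h
      obtain ⟨s', hs', hws'⟩ := mem_gridUnion.1 h'
      exact hs ((not_not.1 hs').of_mem_gridTile hws' hws hw)
    · refine mem_gridUnion.2 ⟨_, fun hs => h ?_, mem_gridTile_floor w⟩
      exact mem_gridUnion.2 ⟨_, not_not.2 hs, mem_gridTile_floor w⟩
  have hopen : IsOpen O := by
    rw [hO']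
    exact (isClosed_gridUnion B).isOpen_compl.inter (isClosed_gridUnion _).isOpen_compl
  have hbdd : Bornology.IsBounded O := by
    have : Finite P := (hI.subset hPI).to_subtype
    refine Bornology.IsBounded.subset (t := gridUnion P) ?_ inter_subset_right
    refine Bornology.isBounded_iUnion.2 fun s => Metric.isBounded_iff.2 ⟨2, ?_⟩
    exact fun x hx y hy => dist_le_of_mem_gridTile hx hy
  refine not_hasLogOn_frontier hbdd (p := p) ⟨hpB, mem_gridUnion.2 ⟨t, ht, hp⟩⟩
    (hlog.mono ?_)
  rw [hopen.frontier_eq]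
  rintro w ⟨hw1, hw2⟩
  by_contra hwB
  exact hw2 ⟨hwB, closure_minimal inter_subset_right (isClosed_gridUnion P) hw1⟩

theorem continuous_complex_mk {X : Type*} [TopologicalSpace X] {a b : X → ℝ}
    (ha : Continuous a) (hb : Continuous b) : Continuous fun x => (⟨a x, b x⟩ : ℂ) :=
  Complex.equivRealProdCLM.symm.continuous.comp (ha.prodMk hb)

/-- The square `[-1, 1] × [-1, 1]` retracts onto the union of three of its sides. -/
theorem exists_retraction_square : ∃ ρ : ℂ → ℂ, Continuous ρ ∧
    (∀ w : ℂ, |w.re| ≤ 1 → |w.im| ≤ 1 → |(ρ w).re| ≤ 1 ∧ |(ρ w).im| ≤ 1 ∧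
      ¬ (|(ρ w).re| < 1 ∧ -1 < (ρ w).im)) ∧
    ∀ w : ℂ, |w.re| ≤ 1 → |w.im| ≤ 1 → ¬ (|w.re| < 1 ∧ -1 < w.im) → ρ w = w := by
  refine ⟨fun w => ⟨max (-1) (min 1 (w.re * (1 + (w.im + 1) / 2))),
    max (-1) (w.im - 4 * (1 - |w.re|))⟩, ?_, ?_, ?_⟩
  · have h1 := Complex.continuous_re
    have h2 := Complex.continuous_im
    exact continuous_complex_mk (by fun_prop) (by fun_prop)
  · intro w h1 h2
    rw [abs_le] at h2
    refine ⟨abs_le.2 ⟨le_max_left _ _, max_le (by norm_num) (min_le_left _ _)⟩,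
      abs_le.2 ⟨le_max_left _ _, max_le (by norm_num) (by linarith)⟩, ?_⟩
    rintro ⟨h3, h4⟩
    simp only [lt_max_iff, lt_irrefl, false_or] at h4
    rw [abs_lt] at h3
    simp only [lt_max_iff, max_lt_iff, lt_irrefl, false_or, lt_min_iff, min_lt_iff] at h3
    obtain ⟨⟨h3, h5⟩, h6, h7⟩ := h3
    rcases abs_cases w.re with h | h <;> nlinarith
  · intro w h1 h2 h3
    rw [abs_le] at h2
    have h1' := abs_le.1 h1
    apply Complex.ext <;> simp only
    · rcases lt_or_eq_of_le h1 with h | h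
      · have : w.im = -1 := le_antisymm (not_lt.1 fun h' => h3 ⟨h, h'⟩) h2.1
        rw [this]
        norm_num
        rw [min_eq_right h1'.2, max_eq_right h1'.1]
      · rcases eq_or_eq_neg_of_abs_eq h with h | h <;> rw [h]
        · rw [min_eq_left (by linarith)]; norm_num
        · rw [max_eq_left]
          exact (min_le_right _ _).trans (by linarith)
    · rcases lt_or_eq_of_le h1 with h | h
      · have : w.im = -1 := le_antisymm (not_lt.1 fun h' => h3 ⟨h, h'⟩) h2.1
        rw [this, max_eq_left (by linarith)]
      · rw [h, max_eq_right] <;> linarith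

/-- The interior of the union of two adjacent tiles. -/
def gridDomino (t t' : ℤ × ℤ) : Set ℂ :=
  {w | ((min t.1 t'.1 : ℤ) : ℝ) < w.re ∧ w.re < ((max t.1 t'.1 : ℤ) : ℝ) + 1 ∧
    ((min t.2 t'.2 : ℤ) : ℝ) < w.im ∧ w.im < ((max t.2 t'.2 : ℤ) : ℝ) + 1}

theorem isOpen_gridDomino (t t' : ℤ × ℤ) : IsOpen (gridDomino t t') := by
  have : gridDomino t t' = (Complex.re ⁻¹' Ioo ((min t.1 t'.1 : ℤ) : ℝ)
      (((max t.1 t'.1 : ℤ) : ℝ) + 1)) ∩ (Complex.im ⁻¹' Ioo ((min t.2 t'.2 : ℤ) : ℝ)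
      (((max t.2 t'.2 : ℤ) : ℝ) + 1)) := by
    ext w; simp only [gridDomino, mem_ofPred_eq, mem_inter_iff, mem_preimage, mem_Ioo, and_assoc]
  rw [this]
  exact (isOpen_Ioo.preimage Complex.continuous_re).inter
    (isOpen_Ioo.preimage Complex.continuous_im)

theorem exists_retraction_gridTile_of_inverse {t t' : ℤ × ℤ} {α β : ℂ → ℂ} (hα : Continuous α)
    (hβ : Continuous β) (hβα : ∀ w, β (α w) = w) (hαβ : ∀ w, α (β w) = w)
    (hT : ∀ w, w ∈ gridTile t ↔ |(α w).re| ≤ 1 ∧ |(α w).im| ≤ 1)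
    (hU : ∀ w ∈ gridTile t, w ∈ gridDomino t t' ↔ |(α w).re| < 1 ∧ -1 < (α w).im) :
    ∃ ρ : ℂ → ℂ, Continuous ρ ∧ (∀ w ∈ gridTile t, ρ w ∈ gridTile t \ gridDomino t t') ∧
      ∀ w ∈ gridTile t \ gridDomino t t', ρ w = w := by
  obtain ⟨ρ, hρ, hmap, hid⟩ := exists_retraction_square
  refine ⟨fun w => β (ρ (α w)), hβ.comp (hρ.comp hα), fun w hw => ?_, fun w hw => ?_⟩
  · obtain ⟨h1, h2, h3⟩ := hmap (α w) ((hT w).1 hw).1 ((hT w).1 hw).2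
    have hmem : β (ρ (α w)) ∈ gridTile t := by
      rw [hT, hαβ]; exact ⟨h1, h2⟩
    refine ⟨hmem, ?_⟩
    rw [hU _ hmem, hαβ]
    exact h3
  · have h := (hU w hw.1).not.1 hw.2
    simp only
    rw [hid (α w) ((hT w).1 hw.1).1 ((hT w).1 hw.1).2 h, hβα]

/-- A tile retracts onto the union of three of its sides. -/
theorem exists_retraction_gridTile {t t' : ℤ × ℤ} (h : GridAdj t t') :
    ∃ ρ : ℂ → ℂ, Continuous ρ ∧ (∀ w ∈ gridTile t, ρ w ∈ gridTile t \ gridDomino t t') ∧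
      ∀ w ∈ gridTile t \ gridDomino t t', ρ w = w := by
  obtain ⟨i, j⟩ := t
  obtain ⟨i', j'⟩ := t'
  have c1 := Complex.continuous_re
  have c2 := Complex.continuous_im
  simp only [GridAdj] at h
  obtain ⟨rfl, rfl | rfl⟩ | ⟨rfl, rfl | rfl⟩ := h
  · refine exists_retraction_gridTile_of_inverse
      (α := fun w => ⟨2 * (w.re - i) - 1, 1 - 2 * (w.im - (j' + 1))⟩)
      (β := fun v => ⟨i + (v.re + 1) / 2, (j' + 1) + (1 - v.im) / 2⟩)
      (continuous_complex_mk (by fun_prop) (by fun_prop))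
      (continuous_complex_mk (by fun_prop) (by fun_prop)) ?_ ?_ ?_ ?_
    · intro w; apply Complex.ext <;> simp only <;> ring
    · intro w; apply Complex.ext <;> simp only <;> ring
    · intro w; simp only [gridTile, mem_ofPred_eq, abs_le]; push_cast; grind
    · intro w
      simp only [gridTile, gridDomino, mem_ofPred_eq, abs_lt, min_self, max_self,
        min_eq_right (by omega : j' ≤ j' + 1), max_eq_left (by omega : j' ≤ j' + 1)]
      push_cast; grind
  · refine exists_retraction_gridTile_of_inverse
      (α := fun w => ⟨2 * (w.re - i) - 1, 2 * (w.im - j) - 1⟩)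
      (β := fun v => ⟨i + (v.re + 1) / 2, j + (v.im + 1) / 2⟩)
      (continuous_complex_mk (by fun_prop) (by fun_prop))
      (continuous_complex_mk (by fun_prop) (by fun_prop)) ?_ ?_ ?_ ?_
    · intro w; apply Complex.ext <;> simp only <;> ring
    · intro w; apply Complex.ext <;> simp only <;> ring
    · intro w; simp only [gridTile, mem_ofPred_eq, abs_le]; grind
    · intro w
      simp only [gridTile, gridDomino, mem_ofPred_eq, abs_lt, min_self, max_self,
        min_eq_left (by omega : j ≤ j + 1), max_eq_right (by omega : j ≤ j + 1)]
      push_cast; grind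
  · refine exists_retraction_gridTile_of_inverse
      (α := fun w => ⟨2 * (w.im - j) - 1, 1 - 2 * (w.re - (i' + 1))⟩)
      (β := fun v => ⟨(i' + 1) + (1 - v.im) / 2, j + (v.re + 1) / 2⟩)
      (continuous_complex_mk (by fun_prop) (by fun_prop))
      (continuous_complex_mk (by fun_prop) (by fun_prop)) ?_ ?_ ?_ ?_
    · intro w; apply Complex.ext <;> simp only <;> ring
    · intro w; apply Complex.ext <;> simp only <;> ring
    · intro w; simp only [gridTile, mem_ofPred_eq, abs_le]; push_cast; grind
    · intro w
      simp only [gridTile, gridDomino, mem_ofPred_eq, abs_lt, min_self, max_self,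
        min_eq_right (by omega : i' ≤ i' + 1), max_eq_left (by omega : i' ≤ i' + 1)]
      push_cast; grind
  · refine exists_retraction_gridTile_of_inverse
      (α := fun w => ⟨2 * (w.im - j) - 1, 2 * (w.re - i) - 1⟩)
      (β := fun v => ⟨i + (v.im + 1) / 2, j + (v.re + 1) / 2⟩)
      (continuous_complex_mk (by fun_prop) (by fun_prop))
      (continuous_complex_mk (by fun_prop) (by fun_prop)) ?_ ?_ ?_ ?_
    · intro w; apply Complex.ext <;> simp only <;> ring
    · intro w; apply Complex.ext <;> simp only <;> ring
    · intro w; simp only [gridTile, mem_ofPred_eq, abs_le]; grind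
    · intro w
      simp only [gridTile, gridDomino, mem_ofPred_eq, abs_lt, min_self, max_self,
        min_eq_left (by omega : i ≤ i + 1), max_eq_right (by omega : i ≤ i + 1)]
      push_cast; grind

/-- The union of the lines bounding the tiles. -/
def gridSkeleton : Set ℂ := {w | (∃ k : ℤ, w.re = k) ∨ ∃ k : ℤ, w.im = k}

theorem isClosed_gridSkeleton : IsClosed gridSkeleton := by
  have : gridSkeleton = (Complex.re ⁻¹' range ((↑) : ℤ → ℝ)) ∪
      (Complex.im ⁻¹' range ((↑) : ℤ → ℝ)) := by
    ext w; simp [gridSkeleton, eq_comm]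
  rw [this]
  exact (Int.isClosedEmbedding_coe_real.isClosed_range.preimage Complex.continuous_re).union
    (Int.isClosedEmbedding_coe_real.isClosed_range.preimage Complex.continuous_im)

/-- Extension of a map over a segment, either of whose endpoints may already be covered. -/
theorem exists_extension_segment {X Y : Type*} [TopologicalSpace X] [TopologicalSpace Y]
    {V : Set Y} (hV : IsPathConnected V) {E : X → Y} (hE : Continuous E) {A : Set X}
    (hEA : MapsTo E A V) {a : ℝ → X} (ha : Continuous a)
    (hA : ∀ s ∈ Ioo (0 : ℝ) 1, a s ∈ A → ∀ s' ∈ Icc (0 : ℝ) 1, a s' ∈ A)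
    {v₀ v₁ : Y} (hv₀ : v₀ ∈ V) (hv₁ : v₁ ∈ V) (h₀ : a 0 ∈ A → v₀ = E (a 0))
    (h₁ : a 1 ∈ A → v₁ = E (a 1)) :
    ∃ h : ℝ → Y, ContinuousOn h (Icc 0 1) ∧ MapsTo h (Icc 0 1) V ∧ h 0 = v₀ ∧ h 1 = v₁ ∧
      ∀ s ∈ Icc (0 : ℝ) 1, a s ∈ A → h s = E (a s) := by
  by_cases hc : ∃ s ∈ Ioo (0 : ℝ) 1, a s ∈ A
  · obtain ⟨s, hs, hsA⟩ := hc
    have hall := hA s hs hsA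
    exact ⟨E ∘ a, (hE.comp ha).continuousOn, fun s' hs' => hEA (hall s' hs'),
      (h₀ (hall 0 (by simp))).symm, (h₁ (hall 1 (by simp))).symm, fun _ _ _ => rfl⟩
  · obtain ⟨γ, hγ⟩ := hV.joinedIn v₀ hv₀ v₁ hv₁
    refine ⟨γ.extend, γ.continuous_extend.continuousOn, fun s hs => ?_, γ.extend_zero,
      γ.extend_one, fun s hs hsA => ?_⟩
    · rw [γ.extend_apply hs]; exact hγ _
    · rcases hs.1.eq_or_lt with rfl | h0
      · rw [γ.extend_zero, h₀ hsA]
      · rcases hs.2.eq_or_lt with rfl | h1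
        · rw [γ.extend_one, h₁ hsA]
        · exact absurd ⟨s, ⟨h0, h1⟩, hsA⟩ hc

theorem horizontal_subset_gridUnion {P : Set (ℤ × ℤ)} {i j : ℤ} {s : ℝ} (hs : s ∈ Ioo (0 : ℝ) 1)
    (h : (⟨i + s, j⟩ : ℂ) ∈ gridUnion P) {s' : ℝ} (hs' : s' ∈ Icc (0 : ℝ) 1) :
    (⟨i + s', j⟩ : ℂ) ∈ gridUnion P := by
  obtain ⟨⟨a, b⟩, hP, h1, h2, h3, h4⟩ := mem_gridUnion.1 h
  simp only at h1 h2 h3 h4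
  have e1 : a < i + 1 := by rw [← Int.cast_lt (R := ℝ)]; push_cast; linarith [hs.2]
  have e2 : i < a + 1 := by rw [← Int.cast_lt (R := ℝ)]; push_cast; linarith [hs.1]
  obtain rfl : a = i := by omega
  exact mem_gridUnion.2 ⟨_, hP, by simpa using hs'.1, by simpa using hs'.2, h3, h4⟩

theorem vertical_subset_gridUnion {P : Set (ℤ × ℤ)} {i j : ℤ} {s : ℝ} (hs : s ∈ Ioo (0 : ℝ) 1)
    (h : (⟨i, j + s⟩ : ℂ) ∈ gridUnion P) {u : ℝ} (hu : u ∈ Icc (0 : ℝ) 1) :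
    (⟨i, j + u⟩ : ℂ) ∈ gridUnion P := by
  obtain ⟨⟨a, b⟩, hP, h1, h2, h3, h4⟩ := mem_gridUnion.1 h
  simp only at h1 h2 h3 h4
  have e1 : b < j + 1 := by rw [← Int.cast_lt (R := ℝ)]; push_cast; linarith [hs.2]
  have e2 : j < b + 1 := by rw [← Int.cast_lt (R := ℝ)]; push_cast; linarith [hs.1]
  obtain rfl : b = j := by omega
  exact mem_gridUnion.2 ⟨_, hP, h1, h2, by simpa using hu.1, by simpa using hu.2⟩

/-- A map on a union of tiles extends over the grid lines, within a path connected set. -/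
theorem exists_extension_gridSkeleton {Y : Type*} [TopologicalSpace Y] {V : Set Y}
    (hV : IsPathConnected V) {E : ℂ → Y} (hE : Continuous E) {P : Set (ℤ × ℤ)}
    (hEP : MapsTo E (gridUnion P) V) :
    ∃ F : ℂ → Y, ContinuousOn F (gridUnion P ∪ gridSkeleton) ∧
      MapsTo F (gridUnion P ∪ gridSkeleton) V ∧ EqOn F E (gridUnion P) := by
  classical
  have hv : ∀ i j : ℤ, ∃ y ∈ V, (⟨i, j⟩ : ℂ) ∈ gridUnion P → y = E ⟨i, j⟩ := by
    intro i j
    by_cases h : (⟨i, j⟩ : ℂ) ∈ gridUnion P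
    · exact ⟨_, hEP h, fun _ => rfl⟩
    · exact ⟨_, hV.nonempty.some_mem, fun h' => absurd h' h⟩
  choose v hvV hvE using hv
  have hh : ∀ i j : ℤ, ∃ h : ℝ → Y, ContinuousOn h (Icc 0 1) ∧ MapsTo h (Icc 0 1) V ∧
      h 0 = v i j ∧ h 1 = v (i + 1) j ∧
      ∀ s ∈ Icc (0 : ℝ) 1, (⟨i + s, j⟩ : ℂ) ∈ gridUnion P → h s = E ⟨i + s, j⟩ := by
    intro i j
    refine exists_extension_segment hV hE hEP (a := fun s => ⟨i + s, j⟩)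
      (continuous_complex_mk (by fun_prop) continuous_const)
      (fun s hs h s' hs' => horizontal_subset_gridUnion hs h hs')
      (hvV i j) (hvV (i + 1) j) ?_ ?_
    · simpa using hvE i j
    · simpa using hvE (i + 1) j
  have hg : ∀ i j : ℤ, ∃ h : ℝ → Y, ContinuousOn h (Icc 0 1) ∧ MapsTo h (Icc 0 1) V ∧
      h 0 = v i j ∧ h 1 = v i (j + 1) ∧
      ∀ s ∈ Icc (0 : ℝ) 1, (⟨i, j + s⟩ : ℂ) ∈ gridUnion P → h s = E ⟨i, j + s⟩ := by
    intro i j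
    refine exists_extension_segment hV hE hEP (a := fun s => ⟨i, j + s⟩)
      (continuous_complex_mk continuous_const (by fun_prop))
      (fun s hs h s' hs' => vertical_subset_gridUnion hs h hs')
      (hvV i j) (hvV i (j + 1)) ?_ ?_
    · simpa using hvE i j
    · simpa using hvE i (j + 1)
  choose h hhc hhV hh0 hh1 hhE using hh
  choose g hgc hgV hg0 hg1 hgE using hg
  set F : ℂ → Y := fun w => if w ∈ gridUnion P then E w else
    if ∃ k : ℤ, w.im = k then h ⌊w.re⌋ ⌊w.im⌋ (Int.fract w.re)
    else g ⌊w.re⌋ ⌊w.im⌋ (Int.fract w.im) with hF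
  have hFE : EqOn F E (gridUnion P) := fun w hw => if_pos hw
  have hFh : ∀ i j : ℤ, ∀ s ∈ Icc (0 : ℝ) 1, F ⟨i + s, j⟩ = h i j s := by
    intro i j s hs
    by_cases hP : (⟨i + s, j⟩ : ℂ) ∈ gridUnion P
    · rw [hFE hP, hhE i j s hs hP]
    · simp only [hF, if_neg hP]
      rw [if_pos ⟨j, rfl⟩]
      rcases hs.2.eq_or_lt with rfl | hs1
      · have : (i : ℝ) + 1 = ((i + 1 : ℤ) : ℝ) := by push_cast; rfl
        rw [this, Int.floor_intCast, Int.floor_intCast, Int.fract_intCast, hh0, hh1]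
      · rw [Int.floor_intCast, Int.floor_intCast_add, Int.fract_intCast_add,
          Int.floor_eq_zero_iff.2 ⟨hs.1, hs1⟩, Int.fract_eq_self.2 ⟨hs.1, hs1⟩, add_zero]
  have hFv : ∀ i j : ℤ, F ⟨i, j⟩ = v i j := by
    intro i j
    have := hFh i j 0 (by simp)
    rwa [add_zero, hh0] at this
  have hFg : ∀ i j : ℤ, ∀ s ∈ Icc (0 : ℝ) 1, F ⟨i, j + s⟩ = g i j s := by
    intro i j s hs
    rcases hs.1.eq_or_lt with rfl | hs0
    · rw [add_zero, hFv, hg0]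
    rcases hs.2.eq_or_lt with rfl | hs1
    · have : (j : ℝ) + 1 = ((j + 1 : ℤ) : ℝ) := by push_cast; rfl
      rw [this, hFv, hg1]
    by_cases hP : (⟨i, j + s⟩ : ℂ) ∈ gridUnion P
    · rw [hFE hP, hgE i j s hs hP]
    · simp only [hF, if_neg hP]
      rw [if_neg, Int.floor_intCast, Int.floor_intCast_add, Int.fract_intCast_add,
          Int.floor_eq_zero_iff.2 ⟨hs.1, hs1⟩, Int.fract_eq_self.2 ⟨hs.1, hs1⟩, add_zero]
      rintro ⟨k, hk⟩
      have e1 : j < k := by rw [← Int.cast_lt (R := ℝ)]; linarith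
      have e2 : k < j + 1 := by rw [← Int.cast_lt (R := ℝ)]; push_cast; linarith
      omega
  set H : ℤ × ℤ → Set ℂ := fun t => gridTile t ∩ Complex.im ⁻¹' {(t.2 : ℝ)} with hH
  set G : ℤ × ℤ → Set ℂ := fun t => gridTile t ∩ Complex.re ⁻¹' {(t.1 : ℝ)} with hG
  have hHF : ∀ t, EqOn F (fun w => h t.1 t.2 (w.re - t.1)) (H t) ∧
      MapsTo (fun w : ℂ => w.re - t.1) (H t) (Icc 0 1) := by
    intro t
    have hm : MapsTo (fun w : ℂ => w.re - t.1) (H t) (Icc 0 1) := fun w hw =>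
      ⟨sub_nonneg.2 hw.1.1, by linarith [hw.1.2.1]⟩
    refine ⟨fun w hw => ?_, hm⟩
    simp only
    rw [← hFh _ _ _ (hm hw)]
    congr 1
    exact Complex.ext (by simp) hw.2
  have hGF : ∀ t, EqOn F (fun w => g t.1 t.2 (w.im - t.2)) (G t) ∧
      MapsTo (fun w : ℂ => w.im - t.2) (G t) (Icc 0 1) := by
    intro t
    have hm : MapsTo (fun w : ℂ => w.im - t.2) (G t) (Icc 0 1) := fun w hw =>
      ⟨sub_nonneg.2 hw.1.2.2.1, by linarith [hw.1.2.2.2]⟩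
    refine ⟨fun w hw => ?_, hm⟩
    simp only
    rw [← hFg _ _ _ (hm hw)]
    congr 1
    exact Complex.ext hw.2 (by simp)
  have hsk : gridSkeleton = (⋃ t, G t) ∪ ⋃ t, H t := by
    ext w
    simp only [gridSkeleton, mem_ofPred_eq, mem_union, mem_iUnion]
    constructor
    · rintro (⟨k, hk⟩ | ⟨k, hk⟩)
      · exact Or.inl ⟨_, mem_gridTile_floor w, by simp [hk]⟩
      · exact Or.inr ⟨_, mem_gridTile_floor w, by simp [hk]⟩
    · rintro (⟨t, _, ht⟩ | ⟨t, _, ht⟩)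
      · exact Or.inl ⟨_, ht⟩
      · exact Or.inr ⟨_, ht⟩
  have hHcl : ∀ t, IsClosed (H t) := fun t =>
    (isClosed_gridTile t).inter (isClosed_singleton.preimage Complex.continuous_im)
  have hGcl : ∀ t, IsClosed (G t) := fun t =>
    (isClosed_gridTile t).inter (isClosed_singleton.preimage Complex.continuous_re)
  have hHlf : LocallyFinite H := locallyFinite_gridTile.subset fun t => inter_subset_left
  have hGlf : LocallyFinite G := locallyFinite_gridTile.subset fun t => inter_subset_left
  refine ⟨F, ?_, ?_, hFE⟩
  · refine (hE.continuousOn.congr hFE).union_of_isClosed ?_ (isClosed_gridUnion P)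
      isClosed_gridSkeleton
    rw [hsk]
    refine ContinuousOn.union_of_isClosed ?_ ?_ (hGlf.isClosed_iUnion hGcl)
      (hHlf.isClosed_iUnion hHcl)
    · refine hGlf.continuousOn_iUnion hGcl fun t => ContinuousOn.congr ?_ (hGF t).1
      exact (hgc t.1 t.2).comp (Complex.continuous_im.sub continuous_const).continuousOn (hGF t).2
    · refine hHlf.continuousOn_iUnion hHcl fun t => ContinuousOn.congr ?_ (hHF t).1
      exact (hhc t.1 t.2).comp (Complex.continuous_re.sub continuous_const).continuousOn (hHF t).2
  · rintro w (hw | hw)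
    · rw [hFE hw]; exact hEP hw
    · rw [hsk] at hw
      simp only [mem_union, mem_iUnion] at hw
      obtain ⟨t, ht⟩ | ⟨t, ht⟩ := hw
      · rw [(hGF t).1 ht]; exact hgV _ _ ((hGF t).2 ht)
      · rw [(hHF t).1 ht]; exact hhV _ _ ((hHF t).2 ht)

theorem IsOuterTile.exists_gridAdj {I B : Set (ℤ × ℤ)} {R : Set (ℤ × ℤ)} (hRI : R ⊆ I)
    {t : ℤ × ℤ} (ht : IsOuterTile I B t) (htR : t ∈ R) :
    ∃ s ∈ R, ∃ s', GridAdj s s' ∧ IsOuterTile I B s' ∧ s' ∉ R := by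
  induction ht with
  | base h => exact absurd (hRI htR) h
  | @step t t' hB hadj hout ih =>
    by_cases h : t' ∈ R
    · exact ih h
    · exact ⟨t, htR, t', hadj, hout, h⟩

theorem eq_or_eq_of_mem_gridDomino {t t' s : ℤ × ℤ} (h : GridAdj t t') {w : ℂ}
    (hw : w ∈ gridDomino t t') (hs : w ∈ gridTile s) : s = t ∨ s = t' := by
  obtain ⟨h1, h2, h3, h4⟩ := hw
  obtain ⟨k1, k2, k3, k4⟩ := hs
  have e1 : min t.1 t'.1 < s.1 + 1 := by rw [← Int.cast_lt (R := ℝ)]; push_cast at *; linarith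
  have e2 : s.1 < max t.1 t'.1 + 1 := by rw [← Int.cast_lt (R := ℝ)]; push_cast at *; linarith
  have e3 : min t.2 t'.2 < s.2 + 1 := by rw [← Int.cast_lt (R := ℝ)]; push_cast at *; linarith
  have e4 : s.2 < max t.2 t'.2 + 1 := by rw [← Int.cast_lt (R := ℝ)]; push_cast at *; linarith
  simp only [GridAdj] at h
  simp only [Prod.ext_iff]
  omega

theorem mem_gridTile_of_mem_gridDomino {t t' : ℤ × ℤ} (h : GridAdj t t') {w : ℂ}
    (hw : w ∈ gridDomino t t') (hs : w ∈ gridSkeleton) : w ∈ gridTile t := by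
  obtain ⟨h1, h2, h3, h4⟩ := hw
  simp only [GridAdj] at h
  rcases hs with ⟨k, hk⟩ | ⟨k, hk⟩
  · rw [hk] at h1 h2
    have e1 : min t.1 t'.1 < k := by exact_mod_cast h1
    have e2 : k < max t.1 t'.1 + 1 := by exact_mod_cast h2
    have e3 : t.1 ≤ k ∧ k ≤ t.1 + 1 ∧ t.2 ≤ min t.2 t'.2 ∧ max t.2 t'.2 ≤ t.2 := by omega
    obtain ⟨f1, f2, f3, f4⟩ := e3
    rw [← Int.cast_le (R := ℝ)] at f1 f2 f3 f4
    push_cast at *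
    exact ⟨by linarith, by linarith, by linarith, by linarith⟩
  · rw [hk] at h3 h4
    have e1 : min t.2 t'.2 < k := by exact_mod_cast h3
    have e2 : k < max t.2 t'.2 + 1 := by exact_mod_cast h4
    have e3 : t.2 ≤ k ∧ k ≤ t.2 + 1 ∧ t.1 ≤ min t.1 t'.1 ∧ max t.1 t'.1 ≤ t.1 := by omega
    obtain ⟨f1, f2, f3, f4⟩ := e3
    rw [← Int.cast_le (R := ℝ)] at f1 f2 f3 f4
    push_cast at *
    exact ⟨by linarith, by linarith, by linarith, by linarith⟩

theorem gridTile_diff_gridDomino_subset (t t' : ℤ × ℤ) :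
    gridTile t \ gridDomino t t' ⊆ gridSkeleton := by
  rintro w ⟨⟨h1, h2, h3, h4⟩, hw⟩
  by_contra hs
  refine hw ?_
  simp only [gridSkeleton, mem_ofPred_eq, not_or, not_exists] at hs
  have e1 : (t.1 : ℝ) < w.re := h1.lt_of_ne (Ne.symm (hs.1 _))
  have e2 : w.re < t.1 + 1 := h2.lt_of_ne (by exact_mod_cast hs.1 (t.1 + 1))
  have e3 : (t.2 : ℝ) < w.im := h3.lt_of_ne (Ne.symm (hs.2 _))
  have e4 : w.im < t.2 + 1 := h4.lt_of_ne (by exact_mod_cast hs.2 (t.2 + 1))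
  have m1 : ((min t.1 t'.1 : ℤ) : ℝ) ≤ t.1 := by exact_mod_cast min_le_left _ _
  have m2 : (t.1 : ℝ) ≤ (max t.1 t'.1 : ℤ) := by exact_mod_cast le_max_left _ _
  have m3 : ((min t.2 t'.2 : ℤ) : ℝ) ≤ t.2 := by exact_mod_cast min_le_left _ _
  have m4 : (t.2 : ℝ) ≤ (max t.2 t'.2 : ℤ) := by exact_mod_cast le_max_left _ _
  exact ⟨by linarith, by linarith, by linarith, by linarith⟩

/-- A map on the tiles which are not outer extends over any finite set of outer tiles, within
a path connected set. -/
theorem exists_extension_gridUnion {Y : Type*} [TopologicalSpace Y] {V : Set Y}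
    (hV : IsPathConnected V) {E : ℂ → Y} (hE : Continuous E) {I B : Set (ℤ × ℤ)}
    (hEP : MapsTo E (gridUnion {t | ¬ IsOuterTile I B t}) V) (R : Finset (ℤ × ℤ))
    (hR : ∀ t ∈ R, t ∈ I ∧ IsOuterTile I B t) :
    ∃ F : ℂ → Y, ContinuousOn F (gridUnion ({t | ¬ IsOuterTile I B t} ∪ R) ∪ gridSkeleton) ∧
      MapsTo F (gridUnion ({t | ¬ IsOuterTile I B t} ∪ R) ∪ gridSkeleton) V ∧
      EqOn F E (gridUnion {t | ¬ IsOuterTile I B t}) := by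
  classical
  set P : Set (ℤ × ℤ) := {t | ¬ IsOuterTile I B t} with hP
  induction R using Finset.strongInduction with
  | H R ih =>
    rcases R.eq_empty_or_nonempty with rfl | ⟨t₀, ht₀⟩
    · simpa using exists_extension_gridSkeleton hV hE hEP
    obtain ⟨t, htR, t', hadj, hout, ht'R⟩ := (hR t₀ ht₀).2.exists_gridAdj (R := (R : Set _))
      (fun s hs => (hR s hs).1) ht₀
    obtain ⟨f, hfc, hfV, hfE⟩ := ih (R.erase t) (Finset.erase_ssubset htR)
      fun s hs => hR s (Finset.mem_of_mem_erase hs)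
    obtain ⟨ρ, hρ, hρmap, hρid⟩ := exists_retraction_gridTile hadj
    set X := gridUnion (P ∪ (R.erase t : Finset (ℤ × ℤ))) ∪ gridSkeleton with hX
    have hdisj : ∀ w ∈ gridUnion (P ∪ (R.erase t : Finset (ℤ × ℤ))), w ∉ gridDomino t t' := by
      intro w hw hwU
      obtain ⟨s, hs, hws⟩ := mem_gridUnion.1 hw
      rcases eq_or_eq_of_mem_gridDomino hadj hwU hws with rfl | rfl
      · rcases hs with hs | hs
        · exact hs (hR s htR).2
        · simp at hs
      · rcases hs with hs | hs
        · exact hs hout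
        · exact ht'R (Finset.mem_of_mem_erase hs)
    have hXcl : IsClosed (X \ gridDomino t t') :=
      ((isClosed_gridUnion _).union isClosed_gridSkeleton).sdiff (isOpen_gridDomino t t')
    have hmaps : ∀ w ∈ gridTile t, ρ w ∈ X \ gridDomino t t' := fun w hw =>
      ⟨Or.inr (gridTile_diff_gridDomino_subset t t' (hρmap w hw)), (hρmap w hw).2⟩
    have hcover : gridUnion (P ∪ R) ∪ gridSkeleton ⊆ (X \ gridDomino t t') ∪ gridTile t := by
      rintro w (hw | hw)
      · obtain ⟨s, hs, hws⟩ := mem_gridUnion.1 hw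
        by_cases hst : s = t
        · exact Or.inr (hst ▸ hws)
        · have : w ∈ gridUnion (P ∪ (R.erase t : Finset (ℤ × ℤ))) :=
            mem_gridUnion.2 ⟨s, hs.imp id fun h => Finset.mem_erase.2 ⟨hst, h⟩, hws⟩
          exact Or.inl ⟨Or.inl this, hdisj w this⟩
      · by_cases hwU : w ∈ gridDomino t t'
        · exact Or.inr (mem_gridTile_of_mem_gridDomino hadj hwU hw)
        · exact Or.inl ⟨Or.inr hw, hwU⟩
    set F : ℂ → Y := fun w => if w ∈ gridTile t then f (ρ w) else f w with hF
    have hF1 : EqOn F (f ∘ ρ) (gridTile t) := fun w hw => if_pos hw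
    have hF2 : EqOn F f (X \ gridDomino t t') := by
      intro w hw
      by_cases hwt : w ∈ gridTile t
      · rw [hF1 hwt, Function.comp_apply, hρid w ⟨hwt, hw.2⟩]
      · exact if_neg hwt
    refine ⟨F, ContinuousOn.mono ?_ hcover, MapsTo.mono_left ?_ hcover, fun w hw => ?_⟩
    · refine ContinuousOn.union_of_isClosed ?_ ?_ hXcl (isClosed_gridTile t)
      · exact (hfc.mono sdiff_subset).congr hF2
      · exact (hfc.comp hρ.continuousOn fun w hw => (hmaps w hw).1).congr hF1
    · rintro w (hw | hw)
      · rw [hF2 hw]; exact hfV hw.1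
      · rw [hF1 hw]; exact hfV (hmaps w hw).1
    · have hw' : w ∈ gridUnion (P ∪ (R.erase t : Finset (ℤ × ℤ))) :=
        gridUnion_mono subset_union_left hw
      rw [hF2 ⟨Or.inl hw', hdisj w hw'⟩, hfE hw]

theorem IsGeodesicSpace.isPathConnected_ball {Z : Type*} [MetricSpace Z]
    (hgeo : IsGeodesicSpace Z) (z : Z) {R : ℝ} (hR : 0 < R) : IsPathConnected (ball z R) := by
  refine ⟨z, mem_ball_self hR, fun {y} hy => ?_⟩
  obtain ⟨γ, h0, h1, hγ⟩ := hgeo z y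
  have hd : dist z y < R := mem_ball'.1 hy
  have hmem : ∀ s ∈ Icc (0 : ℝ) (dist z y), γ s ∈ ball z R := fun s hs => by
    have := hγ 0 ⟨le_rfl, dist_nonneg⟩ s hs
    rw [h0, zero_sub, abs_neg, abs_of_nonneg hs.1] at this
    rw [mem_ball', this]
    exact hs.2.trans_lt hd
  have hcont : ContinuousOn γ (Icc 0 (dist z y)) := by
    refine LipschitzOnWith.continuousOn (K := 1) (LipschitzOnWith.of_dist_le_mul ?_)
    intro s hs t ht
    rw [hγ s hs t ht, NNReal.coe_one, one_mul, Real.dist_eq]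
  have := (convex_Icc (0 : ℝ) (dist z y)).isPathConnected ⟨0, le_rfl, dist_nonneg⟩
  have := this.image' hcont
  have hj := this.joinedIn z ⟨0, ⟨le_rfl, dist_nonneg⟩, h0⟩ y ⟨_, ⟨dist_nonneg, le_rfl⟩, h1⟩
  exact hj.mono (image_subset_iff.2 hmem)

/-- A space homeomorphic to the closed unit ball of `ℝ × ℝ` is parametrized by a large square
in such a way that unit tiles are small in the space. -/
theorem exists_squareChart {Z : Type*} [MetricSpace Z]
    (φ : Z ≃ₜ ↥(closedBall (0 : ℝ × ℝ) 1)) {bdry : Set Z}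
    (hbdry : bdry = {z : Z | ((φ z : ℝ × ℝ)) ∈ sphere (0 : ℝ × ℝ) 1}) {ε : ℝ} (hε : 0 < ε) :
    ∃ (n : ℕ) (Φ : SquareChart Z bdry n), 0 < n ∧ ∀ t x y, Φ.toFun x ∈ gridTile t →
      Φ.toFun y ∈ gridTile t → dist x y < ε := by
  have hcb : ∀ a : ℝ × ℝ, a ∈ closedBall (0 : ℝ × ℝ) 1 ↔ |a.1| ≤ 1 ∧ |a.2| ≤ 1 := fun a => by
    rw [mem_closedBall_zero_iff, Prod.norm_def, max_le_iff, Real.norm_eq_abs, Real.norm_eq_abs]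
  have hφ : ∀ x, |(φ x : ℝ × ℝ).1| ≤ 1 ∧ |(φ x : ℝ × ℝ).2| ≤ 1 := fun x => (hcb _).1 (φ x).2
  have huc : UniformContinuous φ.symm := by
    have : CompactSpace (closedBall (0 : ℝ × ℝ) 1) :=
      isCompact_iff_compactSpace.1 (isCompact_closedBall _ _)
    exact CompactSpace.uniformContinuous_of_continuous φ.symm.continuous
  obtain ⟨δ, hδ, hφδ⟩ := Metric.uniformContinuous_iff.1 huc ε hε
  obtain ⟨n, hn⟩ := exists_nat_gt (2 / δ)
  have hn0 : (0 : ℝ) < n := (div_pos two_pos hδ).trans hn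
  have hclamp : ∀ s : ℝ, |max (-1) (min 1 s)| ≤ 1 := fun s =>
    abs_le.2 ⟨le_max_left _ _, max_le (by norm_num) (min_le_left _ _)⟩
  have c1 : Continuous fun x => (φ x : ℝ × ℝ).1 := by fun_prop
  have c2 : Continuous fun x => (φ x : ℝ × ℝ).2 := by fun_prop
  have hclamp_eq : ∀ s : ℝ, |s| ≤ 1 → max (-1) (min 1 s) = s := fun s hs => by
    rw [abs_le] at hs
    rw [min_eq_right hs.2, max_eq_right hs.1]
  have hcancel : ∀ s : ℝ, 2 * ((n : ℝ) / 2 * (s + 1)) / n - 1 = s := fun s => by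
    field_simp; ring
  refine ⟨n, ⟨fun x => ⟨n / 2 * ((φ x : ℝ × ℝ).1 + 1), n / 2 * ((φ x : ℝ × ℝ).2 + 1)⟩,
    fun w => φ.symm ⟨(max (-1) (min 1 (2 * w.re / n - 1)), max (-1) (min 1 (2 * w.im / n - 1))),
      (hcb _).2 ⟨hclamp _, hclamp _⟩⟩, ?_, ?_, ?_, ?_, ?_, ?_⟩, ?_, ?_⟩
  · exact continuous_complex_mk (by fun_prop) (by fun_prop)
  · have h1 := Complex.continuous_re
    have h2 := Complex.continuous_im
    refine φ.symm.continuous.comp (Continuous.subtype_mk ?_ _)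
    fun_prop
  · intro x
    rw [φ.symm_apply_eq]
    apply Subtype.ext
    apply Prod.ext <;> simp only [hcancel]
    · exact hclamp_eq _ (hφ x).1
    · exact hclamp_eq _ (hφ x).2
  · intro x
    have h1 := abs_le.1 (hφ x).1
    have h2 := abs_le.1 (hφ x).2
    refine ⟨?_, ?_, ?_, ?_⟩ <;> simp only <;> nlinarith
  · rintro w ⟨h1, h2, h3, h4⟩
    have hd : ∀ s : ℝ, 0 ≤ s → s ≤ n → |2 * s / n - 1| ≤ 1 := fun s hs hs' => by
      have e1 : 2 * s / n ≤ 2 := by rw [div_le_iff₀ hn0]; linarith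
      have e2 : 0 ≤ 2 * s / n := by positivity
      exact abs_le.2 ⟨by linarith, by linarith⟩
    apply Complex.ext <;> simp only [Homeomorph.apply_symm_apply]
    · rw [hclamp_eq _ (hd _ h1 h2)]; field_simp; ring
    · rw [hclamp_eq _ (hd _ h3 h4)]; field_simp; ring
  · intro x
    have h1 := (hφ x).1
    have h2 := (hφ x).2
    have key : ∀ s : ℝ, |s| = 1 ↔ (n : ℝ) / 2 * (s + 1) = 0 ∨ (n : ℝ) / 2 * (s + 1) = n := by
      intro s
      rw [abs_eq zero_le_one, or_comm]
      refine or_congr ?_ ?_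
      · rw [mul_eq_zero, or_iff_right (by positivity)]
        constructor <;> intro h <;> linarith
      · constructor
        · rintro rfl; ring
        · intro h
          have : (n : ℝ) * (s - 1) = 0 := by linarith
          rcases mul_eq_zero.1 this with h | h <;> linarith
    rw [hbdry]
    simp only [mem_ofPred_eq, mem_sphere_zero_iff_norm, Prod.norm_def, Real.norm_eq_abs]
    rw [← or_assoc, ← key, ← key]
    constructor
    · intro h
      rcases max_choice |(φ x : ℝ × ℝ).1| |(φ x : ℝ × ℝ).2| with h' | h'
      · exact Or.inl (h'.symm.trans h)
      · exact Or.inr (h'.symm.trans h)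
    · rintro (h | h)
      · rw [h, max_eq_left h2]
      · rw [h, max_eq_right h1]
  · exact_mod_cast hn0
  · rintro t x y ⟨h1, h2, h3, h4⟩ ⟨h1', h2', h3', h4'⟩
    simp only at h1 h2 h3 h4 h1' h2' h3' h4'
    have hlt : 2 < δ * n := by rwa [div_lt_iff₀' hδ] at hn
    have := @hφδ (φ x) (φ y) ?_
    · simpa using this
    rw [Subtype.dist_eq, Prod.dist_eq, max_lt_iff, Real.dist_eq, Real.dist_eq, abs_lt, abs_lt]
    refine ⟨⟨?_, ?_⟩, ?_, ?_⟩ <;>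
    · refine lt_of_mul_lt_mul_left ?_ hn0.le
      linarith

/-- The indices of the tiles of the square `[0, n] × [0, n]`. -/
def squareTiles (n : ℕ) : Set (ℤ × ℤ) := Ico 0 (n : ℤ) ×ˢ Ico 0 (n : ℤ)

theorem finite_squareTiles (n : ℕ) : (squareTiles n).Finite :=
  (finite_Ico _ _).prod (finite_Ico _ _)

theorem gridTile_subset_planeSquare {n : ℕ} {t : ℤ × ℤ} (ht : t ∈ squareTiles n) :
    gridTile t ⊆ planeSquare n := by
  rintro w ⟨h1, h2, h3, h4⟩
  obtain ⟨⟨k1, k2⟩, k3, k4⟩ := ht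
  have e1 : (0 : ℝ) ≤ t.1 := by exact_mod_cast k1
  have e2 : (t.1 : ℝ) + 1 ≤ n := by exact_mod_cast k2
  have e3 : (0 : ℝ) ≤ t.2 := by exact_mod_cast k3
  have e4 : (t.2 : ℝ) + 1 ≤ n := by exact_mod_cast k4
  exact ⟨by linarith, by linarith, by linarith, by linarith⟩

theorem planeSquare_subset_gridUnion {n : ℕ} (hn : 0 < n) :
    planeSquare n ⊆ gridUnion (squareTiles n) := by
  have key : ∀ s : ℝ, 0 ≤ s → s ≤ n → ∃ i : ℤ, i ∈ Ico 0 (n : ℤ) ∧ (i : ℝ) ≤ s ∧ s ≤ i + 1 := by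
    intro s h0 h1
    rcases h1.eq_or_lt with rfl | h
    · exact ⟨n - 1, ⟨by omega, by omega⟩, by push_cast; linarith, by push_cast; linarith⟩
    · exact ⟨⌊s⌋, ⟨Int.floor_nonneg.2 h0, Int.floor_lt.2 (by exact_mod_cast h)⟩,
        Int.floor_le _, (Int.lt_floor_add_one _).le⟩
  rintro w ⟨h1, h2, h3, h4⟩
  obtain ⟨i, hi, hi1, hi2⟩ := key _ h1 h2
  obtain ⟨j, hj, hj1, hj2⟩ := key _ h3 h4
  exact mem_gridUnion.2 ⟨(i, j), ⟨hi, hj⟩, hi1, hi2, hj1, hj2⟩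

theorem convex_planeSquare (n : ℝ) : Convex ℝ (planeSquare n) := by
  have : planeSquare n = (Complex.reLm ⁻¹' Icc 0 n) ∩ (Complex.imLm ⁻¹' Icc 0 n) := by
    ext w; simp [planeSquare, and_assoc]
  rw [this]
  exact ((convex_Icc 0 n).linear_preimage Complex.reLm).inter
    ((convex_Icc 0 n).linear_preimage Complex.imLm)

/-- If no point outside `V` is enclosed by a ball of radius larger than `r`, then the coordinate
square maps to `V` by an extension of the inclusion of the ball of radius `r`. -/
theorem SquareChart.exists_extension_ball {Z : Type*} [MetricSpace Z] {bdry : Set Z} {n : ℕ}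
    (hn : 0 < n) (Φ : SquareChart Z bdry n) {z : Z} {r r' : ℝ} {V : Set Z}
    (hV : IsPathConnected V) (hrV : ball z r' ⊆ V)
    (hsmall : ∀ t x y, Φ.toFun x ∈ gridTile t → Φ.toFun y ∈ gridTile t → dist x y < r' - r)
    (hlog : ∀ p ∉ V, HasLogOn (fun x => Φ.toFun x - Φ.toFun p) (ball z r')) :
    ∃ F : ℂ → Z, ContinuousOn F (planeSquare n) ∧ MapsTo F (planeSquare n) V ∧
      ∀ x ∈ ball z r, F (Φ.toFun x) = x := by
  classical
  set I := squareTiles n with hI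
  set B : Set (ℤ × ℤ) := {t | t ∈ I ∧ ∃ x ∈ ball z r, Φ.toFun x ∈ gridTile t} with hB
  set P : Set (ℤ × ℤ) := {t | ¬ IsOuterTile I B t} with hP
  have hPI : P ⊆ I := fun s hs => not_not.1 fun h => hs (.base h)
  have hBP : B ⊆ P := by
    intro t ht hout
    cases hout with
    | base h => exact h ht.1
    | step h _ _ => exact h ht
  have hBball : MapsTo Φ.param (gridUnion B) (ball z r') := by
    intro w hw
    obtain ⟨t, ⟨htI, x, hx, hxt⟩, hwt⟩ := mem_gridUnion.1 hw
    have := hsmall t (Φ.param w) x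
      (by rwa [Φ.toFun_param w (gridTile_subset_planeSquare htI hwt)]) hxt
    rw [mem_ball] at hx ⊢
    linarith [dist_triangle (Φ.param w) x z]
  have hsq : ∀ S ⊆ I, gridUnion S ⊆ planeSquare n := by
    intro S hS w hw
    obtain ⟨t, ht, hwt⟩ := mem_gridUnion.1 hw
    exact gridTile_subset_planeSquare (hS ht) hwt
  have hPV : MapsTo Φ.param (gridUnion P) V := by
    intro w hw
    by_contra hwV
    obtain ⟨t, ht, hwt⟩ := mem_gridUnion.1 hw
    refine not_hasLogOn_gridUnion (finite_squareTiles n) ht hwt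
      (fun h => hwV (hrV (hBball h))) ?_
    refine ((hlog _ hwV).comp Φ.continuous_param.continuousOn hBball).congr fun w' hw' => ?_
    simp only [Φ.toFun_param w (hsq P hPI hw), Φ.toFun_param w' (hsq B (hBP.trans hPI) hw')]
  obtain ⟨F, hFc, hFV, hFE⟩ := exists_extension_gridUnion hV Φ.continuous_param hPV
    ((finite_squareTiles n).toFinset.filter (IsOuterTile I B)) (fun t ht => by simpa using ht)
  have hsub : planeSquare n ⊆ gridUnion (P ∪
      ((finite_squareTiles n).toFinset.filter (IsOuterTile I B) : Finset (ℤ × ℤ))) ∪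
      gridSkeleton := by
    refine ((planeSquare_subset_gridUnion hn).trans (gridUnion_mono fun t ht => ?_)).trans
      subset_union_left
    by_cases h : IsOuterTile I B t
    · exact Or.inr (by simpa using ⟨ht, h⟩)
    · exact Or.inl h
  refine ⟨F, hFc.mono hsub, hFV.mono_left hsub, fun x hx => ?_⟩
  obtain ⟨t, ht, hxt⟩ := mem_gridUnion.1 (planeSquare_subset_gridUnion hn (Φ.toFun_mem x))
  rw [hFE (mem_gridUnion.2 ⟨t, hBP ⟨ht, x, hx, hxt⟩, hxt⟩), Φ.param_toFun]

/-- **uniform linear local contractibility.** Let `Z` be a compact geodesic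
metric space homeomorphic to the closed disc satisfying (a) the isoperimetric inequality
`ℋ²(Ω) ≤ C ℓ(T)²` for Jordan domains `Ω` of Jordan curves `T` of length `< l₀`, and
(b) the lower area growth bound `ℋ²(B(z,r)) ≥ min{r²/(64C) · π², C l₀²}` for balls not
meeting `∂Z`. Then for every `z ∈ Z` and every `0 < r < l₀/2`, the ball `B(z,r)` is
contractible inside `B(z,(8C+1)r)`. -/
theorem linear_local_contractibility
    (Z : Type*) [MetricSpace Z] [CompactSpace Z]
    [MeasurableSpace Z] [BorelSpace Z]
    (hgeo : IsGeodesicSpace Z)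
    (φ : Z ≃ₜ ↥(Metric.closedBall (0 : ℝ × ℝ) 1))
    (bdry : Set Z)
    (hbdry : bdry = {z : Z | ((φ z : ℝ × ℝ)) ∈ Metric.sphere (0 : ℝ × ℝ) 1})
    (C l₀ : ℝ) (hC : 0 < C) (hl₀ : 0 < l₀)
    (hisop : ∀ T Ω : Set Z, Nonempty (↥T ≃ₜ Circle) →
      IsOpen Ω → IsConnected Ω → frontier Ω = T → Disjoint Ω bdry →
      μH[1] T < ENNReal.ofReal l₀ →
      μH[2] Ω ≤ ENNReal.ofReal C * (μH[1] T) ^ 2)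
    (hgrowth : ∀ (z : Z) (r : ℝ), 0 < r → Disjoint (Metric.ball z r) bdry →
      min (ENNReal.ofReal (π ^ 2 / (64 * C) * r ^ 2)) (ENNReal.ofReal (C * l₀ ^ 2)) ≤
        μH[2] (Metric.ball z r)) :
    ∀ (z : Z) (r : ℝ), ∀ _ : 0 < r, r < l₀ / 2 →
      ∃ p, ∃ hp : p ∈ Metric.ball z ((8 * C + 1) * r),
        ContinuousMap.Homotopic
          (⟨Set.inclusion (Metric.ball_subset_ball (by nlinarith)),
            continuous_inclusion (Metric.ball_subset_ball (by nlinarith))⟩ :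
              C(↥(Metric.ball z r), ↥(Metric.ball z ((8 * C + 1) * r))))
          (ContinuousMap.const ↥(Metric.ball z r) ⟨p, hp⟩) := by
  intro z r hr hrl
  have hCr : 0 < C * r := mul_pos hC hr
  have hπ := Real.pi_gt_three
  have hden : 0 < 16 * C + π := by positivity
  obtain ⟨r', hrr', hr'⟩ := exists_between (lt_min hrl
    (show r < π * ((8 * C + 1) * r) / (16 * C + π) by rw [lt_div_iff₀ hden]; nlinarith))
  obtain ⟨hr'l, hr'C⟩ := lt_min_iff.1 hr'
  rw [lt_div_iff₀ hden] at hr'C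
  have hr'0 : 0 < r' := hr.trans hrr'
  have hfar : 16 * C * r' < π * ((8 * C + 1) * r - r') := by linarith
  have hs : 0 < (8 * C + 1) * r - r' :=
    pos_of_mul_pos_right (lt_trans (by positivity) hfar) Real.pi_pos.le
  have hR : 0 < (8 * C + 1) * r := by positivity
  obtain ⟨n, Φ, hn, hsmall⟩ := exists_squareChart φ hbdry (sub_pos.2 hrr')
  obtain ⟨F, hFc, hFV, hFid⟩ := Φ.exists_extension_ball hn (hgeo.isPathConnected_ball z hR)
    (ball_subset_ball (by linarith)) hsmall fun p hp =>
      hasLogOn_ball_of_far hgeo Φ hC hisop hgrowth hr'0 (by linarith) hs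
        (by rw [mem_ball', not_lt] at hp; linarith) hfar
  have hseg : ∀ q : unitInterval × ball z r,
      (1 - (q.1 : ℝ)) • Φ.toFun q.2 + (q.1 : ℝ) • Φ.toFun z ∈ planeSquare n := fun q =>
    convex_planeSquare n (Φ.toFun_mem _) (Φ.toFun_mem _) (sub_nonneg.2 q.1.2.2) q.1.2.1
      (by ring)
  have hcont := Φ.continuous_toFun
  refine ⟨z, mem_ball_self hR, ⟨⟨⟨fun q => ⟨F ((1 - (q.1 : ℝ)) • Φ.toFun q.2 +
    (q.1 : ℝ) • Φ.toFun z), hFV (hseg q)⟩, ?_⟩, fun x => ?_, fun x => ?_⟩⟩⟩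
  · exact (hFc.comp_continuous (by fun_prop) hseg).subtype_mk _
  · apply Subtype.ext
    simp [hFid x x.2]
  · apply Subtype.ext
    simp [hFid z (mem_ball_self hr)]
end

section
/- Let $Z$ be a compact geodesic metric space homeomorphic to $\overline{D}$, with $A=\mathcal H^2(Z)<\infty$ and $l=\ell_Z(\partial Z)<\infty$, satisfying the ball-growth lower bound $\mathcal H^2(B(p,\rho))\geq\min\{\tfrac{1}{16C}\rho^2, Cl_0^2\}$ for all balls $B(p,\rho)$ disjoint from $\partial Z$. Then for every integer $n>\frac{l}{8Cl_0}$ there exists a subset $F_n\subset Z$ that is $\tfrac{l}{n}$-dense in $Z$ and has at most $2n+64C\frac{A}{l^2}n^2$ elements. -/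
open Set MeasureTheory Metric
open scoped ENNReal

/-- A subset of a compact metric space contains a finite `r`-separated `r`-net of itself. -/
theorem exists_finset_separated_net {X : Type*} [MetricSpace X] [CompactSpace X]
    (S : Set X) {r : ℝ} (hr : 0 < r) :
    ∃ F : Finset X, (∀ x ∈ F, x ∈ S) ∧ (∀ x ∈ F, ∀ y ∈ F, x ≠ y → r < dist x y) ∧
      ∀ z ∈ S, ∃ p ∈ F, dist z p ≤ r := by
  lift r to NNReal using hr.le
  have hr' : r / 2 ≠ 0 := (half_pos (NNReal.coe_pos.mp hr)).ne'
  have hfin : packingNumber r S ≠ ⊤ := by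
    obtain ⟨N, -, hN, hcov⟩ := exists_finite_isCover_of_totallyBounded hr'
      (isCompact_univ.totallyBounded.subset (subset_univ S))
    have h := packingNumber_two_mul_le_externalCoveringNumber (r / 2) S
    rw [mul_div_cancel₀ r two_ne_zero] at h
    exact (h.trans_lt (hcov.externalCoveringNumber_le_encard.trans_lt hN.encard_lt_top)).ne
  have hfinite : (maximalSeparatedSet r S).Finite := by
    rw [← Set.encard_ne_top_iff, encard_maximalSeparatedSet hfin]
    exact hfin
  refine ⟨hfinite.toFinset, fun x hx => maximalSeparatedSet_subset (by simpa using hx),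
    fun x hx y hy hxy => ?_, fun z hz => ?_⟩
  · have h := isSeparated_maximalSeparatedSet (ε := r) (A := S) (by simpa using hx)
      (by simpa using hy) hxy
    simp only [edist_nndist] at h
    exact_mod_cast h
  · have h := isCover_iff_subset_iUnion_closedBall.mp (isCover_maximalSeparatedSet hfin) hz
    simpa using h

/-- Packing bound: disjoint balls of measure at least `c` inside `T` number at most `μ T / c`. -/
theorem card_mul_le_measure_of_separated {X : Type*} [MetricSpace X] [MeasurableSpace X]
    [BorelSpace X] (μ : Measure X) {T : Set X} (hT : MeasurableSet T) (F : Finset X) {r : ℝ}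
    (hF : ∀ x ∈ F, ∀ y ∈ F, x ≠ y → r < dist x y) {c : ℝ≥0∞}
    (hc : ∀ x ∈ F, c ≤ μ (ball x (r / 2) ∩ T)) : F.card * c ≤ μ T := by
  have hd : (F : Set X).PairwiseDisjoint fun x => ball x (r / 2) ∩ T := fun x hx y hy hxy =>
    (ball_disjoint_ball (by linarith [hF x hx y hy hxy])).mono inter_subset_left inter_subset_left
  calc F.card * c = ∑ _x ∈ F, c := by simp
    _ ≤ ∑ x ∈ F, μ (ball x (r / 2) ∩ T) := Finset.sum_le_sum hc
    _ = μ (⋃ x ∈ F, ball x (r / 2) ∩ T) :=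
      (measure_biUnion_finset hd fun x _ => measurableSet_ball.inter hT).symm
    _ ≤ μ T := measure_mono (iUnion₂_subset fun _ _ => inter_subset_right)

/-- A connected set joining the centre of a ball to a point outside it has length at least the
radius inside the ball. -/
theorem ofReal_le_hausdorffMeasure_ball_inter {X : Type*} [MetricSpace X] [MeasurableSpace X]
    [BorelSpace X] {K : Set X} (hK : IsPreconnected K) {p q : X} (hp : p ∈ K) (hq : q ∈ K)
    {r : ℝ} (hr : r ≤ dist q p) : ENNReal.ofReal r ≤ μH[1] (ball p r ∩ K) := by
  have hsub : Ico 0 r ⊆ (fun x => dist x p) '' (ball p r ∩ K) := by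
    intro t ht
    obtain ⟨x, hx, rfl⟩ := hK.intermediate_value hp hq
      (f := fun x => dist x p) (by fun_prop) ⟨by simpa using ht.1, ht.2.le.trans hr⟩
    exact ⟨x, ⟨ht.2, hx⟩, rfl⟩
  calc ENNReal.ofReal r = μH[1] (Ico 0 r) := by simp [hausdorffMeasure_real]
    _ ≤ μH[1] ((fun x => dist x p) '' (ball p r ∩ K)) := measure_mono hsub
    _ ≤ μH[1] (ball p r ∩ K) := by
      simpa using (LipschitzWith.dist_left p).hausdorffMeasure_image_le zero_le_one (ball p r ∩ K)

/-- Two distinct points of a closed curve cut it into two arcs meeting only at these points. -/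
theorem exists_arcs_of_periodic {X : Type*} [TopologicalSpace X] {f : ℝ → X} {T : ℝ}
    (hT : 0 < T) (hf : Continuous f) (hper : Function.Periodic f T)
    (hinj : ∀ s t, f s = f t → ∃ k : ℤ, t - s = k * T) {p q : X} (hp : p ∈ range f)
    (hq : q ∈ range f) (hpq : p ≠ q) :
    ∃ K L : Set X, IsPreconnected K ∧ IsPreconnected L ∧ IsCompact L ∧
      p ∈ K ∧ q ∈ K ∧ p ∈ L ∧ q ∈ L ∧ K ⊆ range f ∧ L ⊆ range f ∧ K ∩ L ⊆ {p, q} := by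
  obtain ⟨a, rfl⟩ := hp
  obtain ⟨b', rfl⟩ := hq
  obtain ⟨b, ⟨hab, hba⟩, hb⟩ := hper.exists_mem_Ico hT b' a
  rw [hb]
  refine ⟨f '' Icc a b, f '' Icc b (a + T), isPreconnected_Icc.image _ hf.continuousOn,
    isPreconnected_Icc.image _ hf.continuousOn, isCompact_Icc.image hf,
    mem_image_of_mem _ (left_mem_Icc.2 hab), mem_image_of_mem _ (right_mem_Icc.2 hab),
    ⟨a + T, right_mem_Icc.2 hba.le, hper a⟩, mem_image_of_mem _ (left_mem_Icc.2 hba.le),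
    image_subset_range _ _, image_subset_range _ _, ?_⟩
  rintro _ ⟨⟨s, hs, rfl⟩, t, ht, hts⟩
  obtain ⟨k, hk⟩ := hinj s t hts.symm
  have hk0 : 0 ≤ k := by
    by_contra! h
    have : (k : ℝ) ≤ -1 := by exact_mod_cast Int.le_sub_one_of_lt h
    nlinarith [hs.2, ht.1]
  obtain rfl | hk1 := hk0.eq_or_lt
  · have : s = b := by
      simp only [Int.cast_zero, zero_mul] at hk
      linarith [hs.2, ht.1]
    simp [this]
  · have h1 : (1 : ℝ) ≤ k := by exact_mod_cast hk1
    have : s = a := by nlinarith [hs.1, ht.2]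
    simp [this]

/-- The radial parametrization of the boundary of the square `[-1, 1]²` by the angle. -/
noncomputable def squareCurve (θ : ℝ) : ℝ × ℝ :=
  ‖(Real.cos θ, Real.sin θ)‖⁻¹ • (Real.cos θ, Real.sin θ)

theorem norm_cos_sin_pos (θ : ℝ) : 0 < ‖(Real.cos θ, Real.sin θ)‖ := by
  rw [norm_pos_iff, Ne, Prod.mk_eq_zero]
  rintro ⟨hc, hs⟩
  simpa [hc, hs] using Real.cos_sq_add_sin_sq θ

theorem norm_squareCurve (θ : ℝ) : ‖squareCurve θ‖ = 1 := by
  rw [squareCurve, norm_smul, norm_inv, norm_norm, inv_mul_cancel₀ (norm_cos_sin_pos θ).ne']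

theorem continuous_squareCurve : Continuous squareCurve := by
  have h : Continuous fun θ : ℝ => (Real.cos θ, Real.sin θ) := by fun_prop
  exact (h.norm.inv₀ fun θ => (norm_cos_sin_pos θ).ne').smul h

theorem periodic_squareCurve : Function.Periodic squareCurve (2 * Real.pi) := fun θ => by
  simp [squareCurve]

theorem exists_squareCurve_eq {v : ℝ × ℝ} (hv : ‖v‖ = 1) : ∃ θ, squareCurve θ = v := by
  set z : ℂ := ⟨v.1, v.2⟩ with hzdef
  have hz : z ≠ 0 := by
    rintro h
    have h1 : v.1 = 0 := congrArg Complex.re h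
    have h2 : v.2 = 0 := congrArg Complex.im h
    simp [Prod.norm_def, h1, h2] at hv
  have hz' : 0 < ‖z‖ := norm_pos_iff.2 hz
  have h : (Real.cos z.arg, Real.sin z.arg) = ‖z‖⁻¹ • v := by
    rw [Complex.cos_arg hz, Complex.sin_arg]
    ext <;> simp [hzdef, div_eq_inv_mul]
  refine ⟨z.arg, ?_⟩
  rw [squareCurve, h, norm_smul, hv, norm_inv, norm_norm, mul_one, inv_inv, smul_smul,
    mul_inv_cancel₀ hz'.ne', one_smul]

theorem sub_eq_of_squareCurve_eq {s t : ℝ} (h : squareCurve s = squareCurve t) :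
    ∃ k : ℤ, t - s = k * (2 * Real.pi) := by
  have hs := inv_pos.2 (norm_cos_sin_pos s)
  have ht := inv_pos.2 (norm_cos_sin_pos t)
  unfold squareCurve at h
  set a := ‖(Real.cos s, Real.sin s)‖⁻¹
  set b := ‖(Real.cos t, Real.sin t)‖⁻¹
  have hc : a * Real.cos s = b * Real.cos t := congrArg Prod.fst h
  have hsn : a * Real.sin s = b * Real.sin t := congrArg Prod.snd h
  have hab : a = b := by
    have : a ^ 2 = b ^ 2 := by
      calc a ^ 2 = (a * Real.cos s) ^ 2 + (a * Real.sin s) ^ 2 := by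
            linear_combination (-a ^ 2) * Real.cos_sq_add_sin_sq s
        _ = b ^ 2 := by
            rw [hc, hsn]
            linear_combination b ^ 2 * Real.cos_sq_add_sin_sq t
    exact (pow_left_inj₀ hs.le ht.le two_ne_zero).1 this
  rw [hab] at hc hsn
  obtain ⟨k, hk⟩ := Real.Angle.angle_eq_iff_two_pi_dvd_sub.1 (Real.Angle.cos_sin_inj
    (mul_left_cancel₀ ht.ne' hc).symm (mul_left_cancel₀ ht.ne' hsn).symm)
  exact ⟨k, by rw [hk, mul_comm]⟩

/-- On a closed curve, a ball centred at a point `p` of the curve that misses another point of the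
curve contains two arcs issuing from `p`, hence length at least twice its radius. -/
theorem ofReal_two_mul_le_hausdorffMeasure_ball_inter {X : Type*} [MetricSpace X]
    [MeasurableSpace X] [BorelSpace X] {f : ℝ → X} {T : ℝ}
    (hT : 0 < T) (hf : Continuous f) (hper : Function.Periodic f T)
    (hinj : ∀ s t, f s = f t → ∃ k : ℤ, t - s = k * T) {p q : X} (hp : p ∈ range f)
    (hq : q ∈ range f) {r : ℝ} (hr : 0 < r) (hpq : r ≤ dist q p) :
    ENNReal.ofReal (2 * r) ≤ μH[1] (ball p r ∩ range f) := by
  have hne : p ≠ q := (dist_pos.1 (hr.trans_le hpq)).symm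
  obtain ⟨K, L, hK, hL, hLc, hpK, hqK, hpL, hqL, hKf, hLf, hKL⟩ :=
    exists_arcs_of_periodic hT hf hper hinj hp hq hne
  have := Measure.nullSingletonClass_hausdorff X zero_lt_one
  have hdisj : AEDisjoint μH[1] (ball p r ∩ K) (ball p r ∩ L) :=
    measure_mono_null (fun x hx => hKL ⟨hx.1.2, hx.2.2⟩) ((Set.toFinite {p, q}).measure_zero _)
  calc ENNReal.ofReal (2 * r) = ENNReal.ofReal r + ENNReal.ofReal r := by
        rw [two_mul, ENNReal.ofReal_add hr.le hr.le]
    _ ≤ μH[1] (ball p r ∩ K) + μH[1] (ball p r ∩ L) :=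
      add_le_add (ofReal_le_hausdorffMeasure_ball_inter hK hpK hqK hpq)
        (ofReal_le_hausdorffMeasure_ball_inter hL hpL hqL hpq)
    _ = μH[1] ((ball p r ∩ K) ∪ (ball p r ∩ L)) :=
      (measure_union₀ (measurableSet_ball.inter hLc.measurableSet).nullMeasurableSet hdisj).symm
    _ ≤ μH[1] (ball p r ∩ range f) :=
      measure_mono (union_subset (inter_subset_inter_right _ hKf) (inter_subset_inter_right _ hLf))

/-- A separated subset of a closed curve has at most (length / separation) points, as soon as it
has two of them. -/
theorem card_mul_le_hausdorffMeasure_range {X : Type*} [MetricSpace X]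
    [MeasurableSpace X] [BorelSpace X] {f : ℝ → X} {T : ℝ}
    (hT : 0 < T) (hf : Continuous f) (hper : Function.Periodic f T)
    (hinj : ∀ s t, f s = f t → ∃ k : ℤ, t - s = k * T) (hmeas : MeasurableSet (range f))
    {r : ℝ} (hr : 0 < r) (F : Finset X) (hFf : ∀ x ∈ F, x ∈ range f)
    (hF : ∀ x ∈ F, ∀ y ∈ F, x ≠ y → r < dist x y) (hcard : 1 < F.card) :
    F.card * ENNReal.ofReal r ≤ μH[1] (range f) := by
  refine card_mul_le_measure_of_separated _ hmeas F hF fun x hx => ?_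
  obtain ⟨y, hy, hyx⟩ := Finset.exists_mem_ne hcard x
  have h := ofReal_two_mul_le_hausdorffMeasure_ball_inter hT hf hper hinj (hFf x hx) (hFf y hy)
    (half_pos hr) (by linarith [hF y hy x hx hyx])
  rwa [mul_div_cancel₀ r two_ne_zero] at h

/-- Transfers a counting bound between extended nonnegative reals and reals. -/
theorem natCast_mul_le_of_mul_ofReal_le {k : ℕ} {c M : ℝ} (hM : 0 ≤ M)
    (h : k * ENNReal.ofReal c ≤ ENNReal.ofReal M) : k * c ≤ M := by
  rwa [← ENNReal.ofReal_natCast, ← ENNReal.ofReal_mul (Nat.cast_nonneg k),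
    ENNReal.ofReal_le_ofReal_iff hM] at h

/-- **equi-compactness.** Let `Z` be a compact geodesic metric space
homeomorphic to the closed disc, with `A = ℋ²(Z) < ∞` and boundary length
`l = ℓ(∂Z) < ∞`, satisfying the ball-growth lower bound
`ℋ²(B(p,ρ)) ≥ min{ρ²/(16C), C l₀²}` for balls disjoint from `∂Z`. Then for every integer
`n > l/(8Cl₀)` there is an `l/n`-dense subset of `Z` with at most
`2n + 64 C (A/l²) n²` elements. -/
theorem equi_compactness_dense_sets
    (Z : Type*) [MetricSpace Z] [CompactSpace Z]
    [MeasurableSpace Z] [BorelSpace Z]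
    (hgeo : IsGeodesicSpace Z)
    (φ : Z ≃ₜ ↥(Metric.closedBall (0 : ℝ × ℝ) 1))
    (bdry : Set Z)
    (hbdry : bdry = {z : Z | ((φ z : ℝ × ℝ)) ∈ Metric.sphere (0 : ℝ × ℝ) 1})
    (C l₀ A l : ℝ) (hC : 0 < C) (hl₀ : 0 < l₀) (hlpos : 0 < l)
    (hA : μH[2] (Set.univ : Set Z) = ENNReal.ofReal A)
    (hl : μH[1] bdry = ENNReal.ofReal l)
    (hgrowth : ∀ (p : Z) (ρ : ℝ), 0 < ρ → Disjoint (Metric.ball p ρ) bdry →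
      min (ENNReal.ofReal (ρ ^ 2 / (16 * C))) (ENNReal.ofReal (C * l₀ ^ 2)) ≤
        μH[2] (Metric.ball p ρ)) :
    ∀ n : ℕ, l / (8 * C * l₀) < (n : ℝ) →
      ∃ F : Finset Z, ((F.card : ℝ) ≤ 2 * n + 64 * C * (A / l ^ 2) * n ^ 2) ∧
        ∀ z : Z, ∃ p ∈ F, dist z p ≤ l / n := by
  intro n hn
  have hn0 : (0 : ℝ) < n := lt_trans (by positivity) hn
  have hn1 : (1 : ℝ) ≤ n := by exact_mod_cast Nat.cast_pos.1 hn0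
  have hmem (θ : ℝ) : squareCurve θ ∈ closedBall (0 : ℝ × ℝ) 1 := by simp [norm_squareCurve]
  let f : ℝ → Z := fun θ => φ.symm ⟨squareCurve θ, hmem θ⟩
  have hf : Continuous f := φ.symm.continuous.comp (continuous_squareCurve.subtype_mk hmem)
  have hper : Function.Periodic f (2 * Real.pi) := fun θ => by
    simp only [f, periodic_squareCurve θ]
  have hinj (s t : ℝ) (h : f s = f t) : ∃ k : ℤ, t - s = k * (2 * Real.pi) :=
    sub_eq_of_squareCurve_eq (Subtype.ext_iff.1 (φ.symm.injective h))
  have hrange : range f = bdry := by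
    subst hbdry
    ext z
    constructor
    · rintro ⟨θ, rfl⟩
      simp [f, norm_squareCurve]
    · intro hz
      obtain ⟨θ, hθ⟩ := exists_squareCurve_eq (mem_sphere_zero_iff_norm.1 hz)
      exact ⟨θ, by simp [f, hθ]⟩
  have hclosed : IsClosed bdry := by
    rw [hbdry]
    exact isClosed_sphere.preimage (continuous_subtype_val.comp φ.continuous)
  have hApos : 0 < A := by
    let o : Z := φ.symm ⟨0, mem_closedBall_self zero_le_one⟩
    have ho : o ∈ bdryᶜ := by simp [hbdry, o]
    obtain ⟨ρ, hρ, hball⟩ := Metric.isOpen_iff.1 hclosed.isOpen_compl o ho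
    have h := (hgrowth o ρ hρ (disjoint_left.2 fun x hx => hball hx)).trans
      (measure_mono (subset_univ _))
    rw [hA] at h
    refine ENNReal.ofReal_pos.1 (lt_of_lt_of_le (lt_min ?_ ?_) h) <;>
      exact ENNReal.ofReal_pos.2 (by positivity)
  obtain ⟨F, hFb, hFsep, hFnet⟩ := exists_finset_separated_net bdry
    (r := l / (2 * n)) (by positivity)
  obtain ⟨G, hGint, hGsep, hGnet⟩ := exists_finset_separated_net
    {z : Z | Disjoint (ball z (l / (2 * n))) bdry} (r := l / n) (by positivity)
  have hFcard : (F.card : ℝ) ≤ 2 * n := by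
    by_cases hcard : 1 < F.card
    · have h := card_mul_le_hausdorffMeasure_range Real.two_pi_pos hf hper hinj
        (hrange ▸ hclosed.measurableSet) (r := l / (2 * n)) (by positivity) F
        (by simpa only [hrange] using hFb) hFsep hcard
      rw [hrange, hl] at h
      have h := natCast_mul_le_of_mul_ofReal_le hlpos.le h
      rw [← mul_div_assoc, div_le_iff₀ (by positivity), mul_comm] at h
      exact le_of_mul_le_mul_left h hlpos
    · have : (F.card : ℝ) ≤ 1 := by exact_mod_cast not_lt.1 hcard
      linarith
  have hGcard : (G.card : ℝ) ≤ 64 * C * (A / l ^ 2) * n ^ 2 := by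
    have hmin : (l / (2 * n)) ^ 2 / (16 * C) ≤ C * l₀ ^ 2 := by
      rw [div_lt_iff₀ (by positivity)] at hn
      have hsq : l ^ 2 ≤ (n * (8 * C * l₀)) ^ 2 := by gcongr
      rw [div_pow, div_div, div_le_iff₀ (by positivity)]
      linarith
    have h := card_mul_le_measure_of_separated μH[2] MeasurableSet.univ G hGsep
      (c := ENNReal.ofReal ((l / (2 * n)) ^ 2 / (16 * C))) fun x hx => by
        have hx' := hgrowth x _ (by positivity) (hGint x hx)
        rw [min_eq_left (ENNReal.ofReal_le_ofReal hmin)] at hx'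
        rwa [inter_univ, show l / n / 2 = l / (2 * n) by rw [div_div, mul_comm]]
    rw [hA] at h
    have h := natCast_mul_le_of_mul_ofReal_le hApos.le h
    calc (G.card : ℝ)
        = G.card * ((l / (2 * n)) ^ 2 / (16 * C)) * (64 * C / l ^ 2 * n ^ 2) := by
          field_simp
          ring
      _ ≤ A * (64 * C / l ^ 2 * n ^ 2) := by gcongr
      _ = 64 * C * (A / l ^ 2) * n ^ 2 := by ring
  classical
  refine ⟨F ∪ G, ?_, fun z => ?_⟩
  · calc ((F ∪ G).card : ℝ) ≤ F.card + G.card := by exact_mod_cast Finset.card_union_le F G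
      _ ≤ _ := add_le_add hFcard hGcard
  · by_cases hz : Disjoint (ball z (l / (2 * n))) bdry
    · obtain ⟨p, hp, hzp⟩ := hGnet z hz
      exact ⟨p, Finset.mem_union_right _ hp, hzp⟩
    · obtain ⟨b, hbz, hb⟩ := not_disjoint_iff.1 hz
      obtain ⟨p, hp, hbp⟩ := hFnet b hb
      refine ⟨p, Finset.mem_union_left _ hp, ?_⟩
      calc dist z p ≤ dist z b + dist b p := dist_triangle z b p
        _ ≤ l / (2 * n) + l / (2 * n) := add_le_add (mem_ball'.1 hbz).le hbp
        _ = l / n := by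
          field_simp
          ring
end

section
/- Let $u:\overline{D}\to X$ be a continuous map to a metric space and define the pseudo-distance $d_u(z_1,z_2)=\inf\{\ell_X(u\circ\gamma):\gamma\text{ a curve in }\overline{D}\text{ from }z_1\text{ to }z_2\}$. Assume $d_u$ is finite-valued and continuous, let $Z$ be the quotient metric space obtained by identifying points at $d_u$-distance $0$, with projection $P:\overline{D}\to Z$. Then for every point $q\in Z$ the fiber $P^{-1}(q)$ is a connected compact subset of $\overline{D}$. -/
open Set MeasureTheory Metric
open scoped ENNReal

local notation "Plane" => (ℝ × ℝ)
local notation "DBar" => Metric.closedBall (0 : Plane) 1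

/-- `γ` is a (continuous) curve in `K` from `z₁` to `z₂`, parametrized on `[0,1]`. -/
def IsCurveIn (K : Set Plane) (z₁ z₂ : Plane) (γ : ℝ → Plane) : Prop :=
  ContinuousOn γ (Icc 0 1) ∧ MapsTo γ (Icc 0 1) K ∧ γ 0 = z₁ ∧ γ 1 = z₂

/-- The intrinsic pseudo-distance induced by `u : closedBall → X`:
`d_u(z₁,z₂) = inf { ℓ_X(u ∘ γ) : γ a curve in the closed disc from z₁ to z₂ }`. -/
noncomputable def inducedPseudoDist {X : Type*} [MetricSpace X] (u : Plane → X)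
    (z₁ z₂ : Plane) : ℝ≥0∞ :=
  sInf {L : ℝ≥0∞ | ∃ γ : ℝ → Plane, IsCurveIn DBar z₁ z₂ γ ∧
    L = eVariationOn (u ∘ γ) (Icc 0 1)}

/-- Reparametrizing an initial piece of a curve bounds the induced pseudo-distance from the
starting point to any point of the curve by the length of the image of the whole curve. -/
theorem inducedPseudoDist_le_eVariationOn {X : Type*} [MetricSpace X] (u : Plane → X)
    {z₁ z₂ : Plane} {γ : ℝ → Plane} (hγ : IsCurveIn DBar z₁ z₂ γ) {t : ℝ}
    (ht : t ∈ Icc (0 : ℝ) 1) :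
    inducedPseudoDist u z₁ (γ t) ≤ eVariationOn (u ∘ γ) (Icc 0 1) := by
  obtain ⟨hc, hm, h0, -⟩ := hγ
  have hmaps : MapsTo (fun s : ℝ => t * s) (Icc 0 1) (Icc 0 1) := fun s hs =>
    ⟨mul_nonneg ht.1 hs.1, mul_le_one₀ ht.2 hs.1 hs.2⟩
  have hmono : MonotoneOn (fun s : ℝ => t * s) (Icc 0 1) := fun a _ b _ hab =>
    mul_le_mul_of_nonneg_left hab ht.1
  refine le_trans (sInf_le ?_) (eVariationOn.comp_le_of_monotoneOn (u ∘ γ) _ hmono hmaps)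
  refine ⟨γ ∘ fun s => t * s, ⟨?_, hm.comp hmaps, ?_, ?_⟩, rfl⟩
  · exact hc.comp (by fun_prop) hmaps
  · simpa using h0
  · simp

/-- A curve joining two disjoint open sets has to leave their union. -/
theorem IsCurveIn.exists_notMem_union {K U V : Set Plane} {z₁ z₂ : Plane} {γ : ℝ → Plane}
    (hγ : IsCurveIn K z₁ z₂ γ) (hU : IsOpen U) (hV : IsOpen V) (hUV : Disjoint U V)
    (h₁ : z₁ ∈ U) (h₂ : z₂ ∈ V) : ∃ t ∈ Icc (0 : ℝ) 1, γ t ∉ U ∪ V := by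
  obtain ⟨hc, -, h0, h1⟩ := hγ
  by_contra! hcover
  obtain ⟨x, -, hxU, hxV⟩ := (isPreconnected_Icc.image γ hc) U V hU hV
    (image_subset_iff.2 hcover)
    ⟨z₁, ⟨0, by simp, h0⟩, h₁⟩ ⟨z₂, ⟨1, by simp, h1⟩, h₂⟩
  exact disjoint_left.1 hUV hxU hxV

/-- Let `u : closedBall → X` be continuous with finite-valued continuous
induced pseudo-distance `d_u`, and let `Z` (with projection `P`) be the quotient metric
space obtained by identifying points at `d_u`-distance `0` (formalized: `P` maps the
closed disc onto `Z` and the distance of `P`-images equals `d_u`). Then every fiber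
`P⁻¹(q)` is a compact connected subset of the closed disc. -/
theorem fibers_of_intrinsic_projection_connected
    {X : Type*} [MetricSpace X] (u : Plane → X)
    (hu : ContinuousOn u DBar)
    (hfin : ∀ z₁ ∈ DBar, ∀ z₂ ∈ DBar, inducedPseudoDist u z₁ z₂ < ⊤)
    (hcont : ContinuousOn
      (fun p : Plane × Plane => (inducedPseudoDist u p.1 p.2).toReal) (DBar ×ˢ DBar))
    (Z : Type*) [MetricSpace Z] (P : Plane → Z)
    (hPsurj : ∀ q : Z, ∃ z ∈ DBar, P z = q)
    (hPdist : ∀ z₁ ∈ DBar, ∀ z₂ ∈ DBar,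
      ENNReal.ofReal (dist (P z₁) (P z₂)) = inducedPseudoDist u z₁ z₂) :
    ∀ q : Z, IsCompact (DBar ∩ P ⁻¹' {q}) ∧ IsConnected (DBar ∩ P ⁻¹' {q}) := by
  have hdist : ∀ z₁ ∈ DBar, ∀ z₂ ∈ DBar,
      dist (P z₁) (P z₂) = (inducedPseudoDist u z₁ z₂).toReal := fun z₁ h₁ z₂ h₂ => by
    rw [← hPdist z₁ h₁ z₂ h₂, ENNReal.toReal_ofReal dist_nonneg]
  have hPcont : ContinuousOn P DBar := by
    intro z hz
    refine tendsto_iff_dist_tendsto_zero.2 ?_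
    have hslice : ContinuousOn (fun w => (inducedPseudoDist u w z).toReal) DBar :=
      hcont.comp (f := fun w : Plane => (w, z)) (by fun_prop) fun w hw => ⟨hw, hz⟩
    have hlim := hslice z hz
    rw [ContinuousWithinAt, ← hdist z hz z hz, dist_self] at hlim
    exact hlim.congr' (eventually_nhdsWithin_of_forall fun w hw => (hdist w hw z hz).symm)
  have hD : IsCompact DBar := isCompact_closedBall _ _
  intro q
  have hF : IsCompact (DBar ∩ P ⁻¹' {q}) :=
    hD.of_isClosed_subset (hPcont.preimage_isClosed_of_isClosed isClosed_closedBall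
      isClosed_singleton) inter_subset_left
  obtain ⟨z, hz, hzq⟩ := hPsurj q
  refine ⟨hF, ⟨z, hz, hzq⟩, ?_⟩
  rintro U V hU hV hcover ⟨k₁, hk₁, hk₁U⟩ ⟨k₂, hk₂, hk₂V⟩
  by_contra hempty
  have hUV : ∀ x ∈ DBar ∩ P ⁻¹' {q}, x ∈ U → x ∉ V := fun x hx hxU hxV =>
    hempty ⟨x, hx, hxU, hxV⟩
  obtain ⟨U', V', hU', hV', hsubU, hsubV, hdisj⟩ :=
    SeparatedNhds.of_isCompact_isCompact (hF.diff hV) (hF.diff hU)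
      (disjoint_left.2 fun x hx hx' => (hcover hx.1).elim hx'.2 hx.2)
  have hPS : IsClosed (P '' (DBar \ (U' ∪ V'))) :=
    ((hD.diff (hU'.union hV')).image_of_continuousOn (hPcont.mono sdiff_subset)).isClosed
  have hqS : q ∈ (P '' (DBar \ (U' ∪ V')))ᶜ := by
    rintro ⟨s, ⟨hsD, hs⟩, hsq⟩
    have hsF : s ∈ DBar ∩ P ⁻¹' {q} := ⟨hsD, hsq⟩
    by_cases hsV : s ∈ V
    · exact hs (Or.inr (hsubV ⟨hsF, fun hsU => hUV s hsF hsU hsV⟩))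
    · exact hs (Or.inl (hsubU ⟨hsF, hsV⟩))
  obtain ⟨ε, hε, hball⟩ := Metric.isOpen_iff.1 hPS.isOpen_compl q hqS
  have hzero : inducedPseudoDist u k₁ k₂ < ENNReal.ofReal ε := by
    rw [← hPdist k₁ hk₁.1 k₂ hk₂.1, show P k₁ = q from hk₁.2, show P k₂ = q from hk₂.2]
    simpa using hε
  obtain ⟨-, ⟨γ, hγ, rfl⟩, hlt⟩ := sInf_lt_iff.1 hzero
  obtain ⟨t, ht, htS⟩ := hγ.exists_notMem_union hU' hV' hdisj
    (hsubU ⟨hk₁, hUV k₁ hk₁ hk₁U⟩) (hsubV ⟨hk₂, fun h => hUV k₂ hk₂ h hk₂V⟩)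
  have hγt : γ t ∈ DBar := hγ.2.1 ht
  have hclose := (inducedPseudoDist_le_eVariationOn u hγ ht).trans_lt hlt
  rw [← hPdist k₁ hk₁.1 _ hγt, ENNReal.ofReal_lt_ofReal_iff hε, show P k₁ = q from hk₁.2,
    dist_comm] at hclose
  exact hball hclose ⟨γ t, ⟨hγt, htS⟩, rfl⟩
end
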